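/- Let P be a finite set of points in ℝ² in general position, let T be an order-1 Delaunay triangulation of P, and let {u,v} be an edge of T (a side of some triangle of T) that is a useful order-1 Delaunay edge but not a Delaunay edge. Then the two triangles of T adjacent to uv, say u v a and u v b, form a convex quadrilateral; the diagonal {a,b} obtained by flipping uv is a Delaunay edge; and the four edges {u,a}, {u,b}, {v,a}, {v,b} are 1-fixed edges. -/

import Mathlib

open EuclideanGeometry Set

noncomputable section

/-- Points of the Euclidean plane. -/
abbrev Pt : Type := EuclideanSpace ℝ (Fin 2)

noncomputable instance : DecidableEq Pt := Classical.decEq _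

/-- `P` is in general position: no three (distinct) points collinear and
no four (distinct) points concyclic. -/
def GenPos (P : Set Pt) : Prop :=
  (∀ u v w : Pt, u ∈ P → v ∈ P → w ∈ P → u ≠ v → u ≠ w → v ≠ w →
    ¬ Collinear ℝ ({u, v, w} : Set Pt)) ∧
  (∀ u v w z : Pt, u ∈ P → v ∈ P → w ∈ P → z ∈ P →
    u ≠ v → u ≠ w → u ≠ z → v ≠ w → v ≠ z → w ≠ z →
    ¬ EuclideanGeometry.Cospherical ({u, v, w, z} : Set Pt))

/-- The (closed) triangle spanned by a finite set of points. -/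
def triSet (t : Finset Pt) : Set Pt := convexHull ℝ (t : Set Pt)

/-- `T` is a triangulation of `P`: a finite set of triangles with vertices in `P`,
every point of `P` is a vertex of some triangle, the interiors of the triangles are
pairwise disjoint, and their union is the convex hull of `P`. -/
def IsTriangulation (P : Set Pt) (T : Set (Finset Pt)) : Prop :=
  T.Finite ∧
  (∀ t ∈ T, t.card = 3 ∧ (t : Set Pt) ⊆ P) ∧
  (∀ p ∈ P, ∃ t ∈ T, p ∈ t) ∧
  (T.Pairwise fun t s => interior (triSet t) ∩ interior (triSet s) = ∅) ∧
  (⋃ t ∈ T, triSet t) = convexHull ℝ P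

/-- The triangle `t` (with vertex set `t`) is order-`k` Delaunay with respect to `P`:
the open disk bounded by its circumcircle contains at most `k` points of `P`. -/
def OrderKTri (P : Set Pt) (k : ℕ) (t : Finset Pt) : Prop :=
  ∃ z : Pt, ∃ r : ℝ, (∀ p ∈ t, dist p z = r) ∧ {p ∈ P | dist p z < r}.encard ≤ (k : ℕ∞)

/-- `T` is an order-`k` Delaunay triangulation of `P`. -/
def IsOrderDT (P : Set Pt) (k : ℕ) (T : Set (Finset Pt)) : Prop :=
  IsTriangulation P T ∧ ∀ t ∈ T, OrderKTri P k t

/-- `{u, v}` is an order-`k` Delaunay edge of `P`: some open disk having `u` and `v`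
on its boundary circle contains at most `k` points of `P`. -/
def OrderKEdge (P : Set Pt) (k : ℕ) (u v : Pt) : Prop :=
  ∃ z : Pt, ∃ r : ℝ, dist u z = r ∧ dist v z = r ∧ {p ∈ P | dist p z < r}.encard ≤ (k : ℕ∞)

/-- `{u, v}` is a useful order-`k` Delaunay edge of `P`: some order-`k` Delaunay
triangulation of `P` contains a triangle having `u` and `v` among its vertices
(i.e. having segment `uv` as a side). -/
def UsefulEdge (P : Set Pt) (k : ℕ) (u v : Pt) : Prop :=
  ∃ T, IsOrderDT P k T ∧ ∃ t ∈ T, u ∈ t ∧ v ∈ t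

/-- `{u, v}` is a Delaunay edge: it is an edge of the (unique) order-0 Delaunay
triangulation of `P`. -/
def DelaunayEdge (P : Set Pt) (u v : Pt) : Prop := UsefulEdge P 0 u v

/-- `p` lies strictly to the left of the directed line from `v` to `u`, i.e. the
triple `v, u, p` makes a counterclockwise turn. -/
def ccw (v u p : Pt) : Prop :=
  0 < (u 0 - v 0) * (p 1 - v 1) - (u 1 - v 1) * (p 0 - v 0)


/-- A Delaunay edge `{u,v}` is `k`-fixed if it is present (as the side of some triangle)
in every order-`k` Delaunay triangulation of `P`. -/
def KFixed (P : Set Pt) (k : ℕ) (u v : Pt) : Prop :=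
  DelaunayEdge P u v ∧ ∀ T, IsOrderDT P k T → ∃ t ∈ T, u ∈ t ∧ v ∈ t


/-- Twice the signed area of the triangle `a b c`. -/
def cr (a b c : Pt) : ℝ := (b 0 - a 0) * (c 1 - a 1) - (b 1 - a 1) * (c 0 - a 0)

theorem pt_ext {p q : Pt} (h0 : p 0 = q 0) (h1 : p 1 = q 1) : p = q := by
  ext i; fin_cases i
  · exact h0
  · exact h1

theorem cr_comb (u v x y z : Pt) {α β γ : ℝ} (h : α + β + γ = 1) :
    cr u v (α • x + β • y + γ • z) = α * cr u v x + β * cr u v y + γ * cr u v z := by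
  obtain rfl : α = 1 - β - γ := by linarith
  simp [cr]; ring

theorem cr_comb₂ (u v x y : Pt) {α β : ℝ} (h : α + β = 1) :
    cr u v (α • x + β • y) = α * cr u v x + β * cr u v y := by
  obtain rfl : α = 1 - β := by linarith
  simp [cr]; ring

theorem cr_left (u v : Pt) : cr u v u = 0 := by simp [cr]

theorem cr_right (u v : Pt) : cr u v v = 0 := by simp [cr]; ring

theorem cr_rotate (a b c : Pt) : cr b c a = cr a b c := by simp [cr]; ring

theorem exists_barycentric {x y z : Pt} (h : cr x y z ≠ 0) (w : Pt) :
    ∃ α β γ : ℝ, α + β + γ = 1 ∧ w = α • x + β • y + γ • z := by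
  refine ⟨cr y z w / cr x y z, cr z x w / cr x y z, cr x y w / cr x y z, ?_, ?_⟩
  · field_simp; simp [cr]; ring
  · apply pt_ext <;>
    · simp only [PiLp.add_apply, PiLp.smul_apply, smul_eq_mul]
      field_simp
      simp only [cr]; ring

theorem collinear_of_cr_eq_zero {x y z : Pt} (hxy : x ≠ y) (h : cr x y z = 0) :
    Collinear ℝ ({x, y, z} : Set Pt) := by
  rw [collinear_iff_of_mem (p₀ := x) (by simp)]
  have hd : (y 0 - x 0) ^ 2 + (y 1 - x 1) ^ 2 ≠ 0 := by
    intro h0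
    apply hxy
    apply pt_ext
    · nlinarith [sq_nonneg (y 0 - x 0), sq_nonneg (y 1 - x 1)]
    · nlinarith [sq_nonneg (y 0 - x 0), sq_nonneg (y 1 - x 1)]
  refine ⟨y - x, ?_⟩
  simp only [mem_insert_iff, mem_singleton_iff, forall_eq_or_imp, forall_eq, vadd_eq_add]
  refine ⟨⟨0, by simp⟩, ⟨1, by simp⟩,
    ⟨((z 0 - x 0) * (y 0 - x 0) + (z 1 - x 1) * (y 1 - x 1)) /
      ((y 0 - x 0) ^ 2 + (y 1 - x 1) ^ 2), ?_⟩⟩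
  unfold cr at h
  apply pt_ext <;> simp <;> field_simp
  · linear_combination (-(y 1 - x 1)) * h
  · linear_combination (y 0 - x 0) * h

theorem GenPos.cr_ne_zero {P : Set Pt} (hgp : GenPos P) {x y z : Pt} (hx : x ∈ P) (hy : y ∈ P)
    (hz : z ∈ P) (hxy : x ≠ y) (hxz : x ≠ z) (hyz : y ≠ z) : cr x y z ≠ 0 := fun h =>
  hgp.1 x y z hx hy hz hxy hxz hyz (collinear_of_cr_eq_zero hxy h)

theorem not_collinear_of_cr_ne_zero {x y z : Pt} (h : cr x y z ≠ 0) :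
    ¬ Collinear ℝ ({x, y, z} : Set Pt) := by
  intro hc
  rw [collinear_iff_of_mem (p₀ := x) (by simp)] at hc
  obtain ⟨v, hv⟩ := hc
  obtain ⟨r, hr⟩ := hv y (by simp)
  obtain ⟨s, hs⟩ := hv z (by simp)
  apply h
  subst hr hs
  simp [cr]; ring

/-! ### Circle functions -/

/-- `f` is the power of a point with respect to some (possibly imaginary) circle. -/
def IsCircleFun (f : Pt → ℝ) : Prop :=
  ∃ A B C : ℝ, ∀ w : Pt, f w = w 0 ^ 2 + w 1 ^ 2 + A * w 0 + B * w 1 + C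

theorem dist_sq_eq (x y : Pt) : dist x y ^ 2 = (x 0 - y 0) ^ 2 + (x 1 - y 1) ^ 2 := by
  rw [EuclideanSpace.dist_eq, Real.sq_sqrt (by positivity)]
  simp [Fin.sum_univ_two, Real.dist_eq, sq_abs]

theorem isCircleFun_dist (z : Pt) (r : ℝ) : IsCircleFun fun w => dist w z ^ 2 - r ^ 2 :=
  ⟨-2 * z 0, -2 * z 1, z 0 ^ 2 + z 1 ^ 2 - r ^ 2, fun w => by
    simp only [dist_sq_eq]; ring⟩

theorem IsCircleFun.exists_disk {f : Pt → ℝ} (hf : IsCircleFun f) {p : Pt} (hp : f p = 0) :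
    ∃ (z : Pt) (r : ℝ), 0 ≤ r ∧ ∀ w, f w = dist w z ^ 2 - r ^ 2 := by
  obtain ⟨A, B, C, h⟩ := hf
  refine ⟨!₂[-A / 2, -B / 2], dist p !₂[-A / 2, -B / 2], dist_nonneg, fun w => ?_⟩
  rw [dist_sq_eq, dist_sq_eq, ← sub_zero (f w), ← hp, h, h]
  simp; ring

theorem IsCircleFun.sub_comb {f g : Pt → ℝ} (hf : IsCircleFun f) (hg : IsCircleFun g)
    (x y z : Pt) {α β γ : ℝ} (h : α + β + γ = 1) :
    f (α • x + β • y + γ • z) - g (α • x + β • y + γ • z) =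
      α * (f x - g x) + β * (f y - g y) + γ * (f z - g z) := by
  obtain ⟨A, B, C, hf⟩ := hf
  obtain ⟨A', B', C', hg⟩ := hg
  obtain rfl : α = 1 - β - γ := by linarith
  simp [hf, hg]; ring

theorem IsCircleFun.sub_comb₂ {f g : Pt → ℝ} (hf : IsCircleFun f) (hg : IsCircleFun g)
    (x y : Pt) {α β : ℝ} (h : α + β = 1) :
    f (α • x + β • y) - g (α • x + β • y) = α * (f x - g x) + β * (f y - g y) := by
  have := hf.sub_comb hg x y x (α := α) (β := β) (γ := 0) (by linarith)
  simpa using this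

theorem IsCircleFun.comb₂ {f : Pt → ℝ} (hf : IsCircleFun f) (x y : Pt) {α β : ℝ}
    (h : α + β = 1) :
    f (α • x + β • y) = α * f x + β * f y - α * β * dist x y ^ 2 := by
  obtain ⟨A, B, C, hf⟩ := hf
  obtain rfl : α = 1 - β := by linarith
  simp [hf, dist_sq_eq]; ring

theorem exists_circleFun {x y z : Pt} (h : cr x y z ≠ 0) :
    ∃ f, IsCircleFun f ∧ f x = 0 ∧ f y = 0 ∧ f z = 0 := by
  set a := y 0 - x 0 with ha
  set b := y 1 - x 1 with hb
  set c := z 0 - x 0 with hc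
  set d := z 1 - x 1 with hd
  have hD : a * d - b * c ≠ 0 := h
  set m := (x 0 ^ 2 + x 1 ^ 2) - (y 0 ^ 2 + y 1 ^ 2) with hm
  set n := (x 0 ^ 2 + x 1 ^ 2) - (z 0 ^ 2 + z 1 ^ 2) with hn
  obtain ⟨A, B, h1, h2⟩ : ∃ A B : ℝ, A * a + B * b = m ∧ A * c + B * d = n := by
    refine ⟨(m * d - n * b) / (a * d - b * c), (a * n - c * m) / (a * d - b * c), ?_, ?_⟩
    · rw [div_mul_eq_mul_div, div_mul_eq_mul_div, ← add_div, div_eq_iff hD]; ring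
    · rw [div_mul_eq_mul_div, div_mul_eq_mul_div, ← add_div, div_eq_iff hD]; ring
  refine ⟨fun w => w 0 ^ 2 + w 1 ^ 2 + A * w 0 + B * w 1 -
    (x 0 ^ 2 + x 1 ^ 2 + A * x 0 + B * x 1),
    ⟨A, B, -(x 0 ^ 2 + x 1 ^ 2 + A * x 0 + B * x 1), fun w => by ring⟩, by ring, ?_, ?_⟩
  · simp only [ha, hb, hm] at h1
    linear_combination h1
  · simp only [hc, hd, hn] at h2
    linear_combination h2

theorem GenPos.not_concyclic {P : Set Pt} (hgp : GenPos P) {f : Pt → ℝ} (hf : IsCircleFun f)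
    {x y z w : Pt} (hx : x ∈ P) (hy : y ∈ P) (hz : z ∈ P) (hw : w ∈ P) (hxy : x ≠ y)
    (hxz : x ≠ z) (hyz : y ≠ z) (fx : f x = 0) (fy : f y = 0) (fz : f z = 0) (fw : f w = 0) :
    w = x ∨ w = y ∨ w = z := by
  by_contra! hne
  obtain ⟨c, r, hr, h⟩ := hf.exists_disk fx
  have key : ∀ p, f p = 0 → dist p c = r := fun p hp => by
    rw [h, sub_eq_zero] at hp
    exact (sq_eq_sq₀ dist_nonneg hr).1 hp
  refine hgp.2 x y z w hx hy hz hw hxy hxz hne.1.symm hyz hne.2.1.symm hne.2.2.symm ⟨c, r, ?_⟩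
  simp only [mem_insert_iff, mem_singleton_iff, forall_eq_or_imp, forall_eq]
  exact ⟨key x fx, key y fy, key z fz, key w fw⟩

theorem orderKTri_iff {P : Set Pt} {k : ℕ} {t : Finset Pt} (ht : t.Nonempty) :
    OrderKTri P k t ↔ ∃ f, IsCircleFun f ∧ (∀ p ∈ t, f p = 0) ∧
      {p ∈ P | f p < 0}.encard ≤ (k : ℕ∞) := by
  obtain ⟨p₀, hp₀⟩ := ht
  constructor
  · rintro ⟨z, r, h, hk⟩
    have hr : 0 ≤ r := h p₀ hp₀ ▸ dist_nonneg
    refine ⟨_, isCircleFun_dist z r, fun p hp => by simp [h p hp], ?_⟩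
    convert hk using 4 with p
    rw [sub_neg, sq_lt_sq₀ dist_nonneg hr]
  · rintro ⟨f, hf, h, hk⟩
    obtain ⟨z, r, hr, hfz⟩ := hf.exists_disk (h p₀ hp₀)
    refine ⟨z, r, fun p hp => ?_, ?_⟩
    · have := h p hp
      rw [hfz, sub_eq_zero] at this
      exact (sq_eq_sq₀ dist_nonneg hr).1 this
    · convert hk using 4 with p
      rw [hfz, sub_neg, sq_lt_sq₀ dist_nonneg hr]

/-- A point of the line `xy` where a circle function is negative lies strictly between `x` and `y`
if the function vanishes there. -/
theorem IsCircleFun.pos_of_neg {f : Pt → ℝ} (hf : IsCircleFun f) {x y : Pt} {α β : ℝ}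
    (h : α + β = 1) (hx : f x = 0) (hy : f y = 0) (hneg : f (α • x + β • y) < 0) :
    0 < α ∧ 0 < β := by
  rw [hf.comb₂ x y h, hx, hy] at hneg
  have hd : 0 < α * β := by
    by_contra! hle
    nlinarith [mul_nonneg (neg_nonneg.2 hle) (sq_nonneg (dist x y))]
  rcases pos_and_pos_or_neg_and_neg_of_mul_pos hd with h' | h'
  · exact h'
  · linarith [h'.1, h'.2]

/-! ### Triangles -/

theorem mem_triSet {x y z w : Pt} :
    w ∈ triSet {x, y, z} ↔ ∃ α β γ : ℝ, 0 ≤ α ∧ 0 ≤ β ∧ 0 ≤ γ ∧ α + β + γ = 1 ∧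
      w = α • x + β • y + γ • z := by
  unfold triSet
  simp only [Finset.coe_insert, Finset.coe_singleton]
  constructor
  · intro h
    rw [convexHull_insert (by simp), convexHull_pair, mem_convexJoin] at h
    obtain ⟨x', hx', q, ⟨b, c, hb, hc, hbc, rfl⟩, ⟨d, e, hd, he, hde, rfl⟩⟩ := h
    obtain rfl : x' = x := hx'
    exact ⟨d, e * b, e * c, hd, by positivity, by positivity,
      by rw [add_assoc, ← mul_add, hbc, mul_one, hde], by module⟩
  · rintro ⟨α, β, γ, hα, hβ, hγ, h, rfl⟩
    have hconv := convex_convexHull ℝ ({x, y, z} : Set Pt)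
    have hsub := subset_convexHull ℝ ({x, y, z} : Set Pt)
    have := hconv.sum_mem (t := Finset.univ) (w := ![α, β, γ]) (z := ![x, y, z])
      (by intro i _; fin_cases i <;> simpa) (by simpa [Fin.sum_univ_three] using h)
      (by intro i _; apply hsub; fin_cases i <;> simp)
    simpa [Fin.sum_univ_three] using this

theorem isClosed_triSet (t : Finset Pt) : IsClosed (triSet t) :=
  (t.finite_toSet.isCompact_convexHull (𝕜 := ℝ)).isClosed

theorem mem_interior_triSet {x y z w : Pt} (h : cr x y z ≠ 0) :
    w ∈ interior (triSet {x, y, z}) ↔ ∃ α β γ : ℝ, 0 < α ∧ 0 < β ∧ 0 < γ ∧ α + β + γ = 1 ∧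
      w = α • x + β • y + γ • z := by
  have hind : AffineIndependent ℝ ![x, y, z] :=
    affineIndependent_iff_not_collinear_set.2 (not_collinear_of_cr_ne_zero h)
  have htop : affineSpan ℝ (range ![x, y, z]) = ⊤ := by
    rw [hind.affineSpan_eq_top_iff_card_eq_finrank_add_one]
    simp
  let b : AffineBasis (Fin 3) ℝ Pt := ⟨![x, y, z], hind, htop⟩
  have hb : ⇑b = ![x, y, z] := rfl
  have hrange : triSet {x, y, z} = convexHull ℝ (range b) := by
    unfold triSet
    rw [hb]
    congr 1
    ext p
    simp [eq_comm]
    tauto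
  rw [hrange, AffineBasis.interior_convexHull]
  constructor
  · intro hw
    refine ⟨b.coord 0 w, b.coord 1 w, b.coord 2 w, hw 0, hw 1, hw 2, ?_, ?_⟩
    · rw [← b.sum_coord_apply_eq_one w, Fin.sum_univ_three]
    · conv_lhs => rw [← b.linear_combination_coord_eq_self w, Fin.sum_univ_three]
      rfl
  · rintro ⟨α, β, γ, hα, hβ, hγ, hsum, rfl⟩ i
    have hs : Finset.univ.sum ![α, β, γ] = 1 := by simpa [Fin.sum_univ_three] using hsum
    have he : α • x + β • y + γ • z =
        Finset.univ.affineCombination ℝ b ![α, β, γ] := by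
      rw [Finset.affineCombination_eq_linear_combination _ _ _ hs]
      simp [Fin.sum_univ_three, hb]
    rw [he, b.coord_apply_combination_of_mem (Finset.mem_univ i) hs]
    fin_cases i <;> simpa

theorem GenPos.exists_triple {P : Set Pt} (hgp : GenPos P) {t : Finset Pt} (hc : t.card = 3)
    (ht : (t : Set Pt) ⊆ P) :
    ∃ x y z, t = {x, y, z} ∧ x ∈ P ∧ y ∈ P ∧ z ∈ P ∧ x ≠ y ∧ x ≠ z ∧ y ≠ z ∧
      cr x y z ≠ 0 := by
  obtain ⟨x, y, z, hxy, hxz, hyz, rfl⟩ := Finset.card_eq_three.1 hc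
  have hx : x ∈ P := ht (by simp)
  have hy : y ∈ P := ht (by simp)
  have hz : z ∈ P := ht (by simp)
  exact ⟨x, y, z, rfl, hx, hy, hz, hxy, hxz, hyz, hgp.cr_ne_zero hx hy hz hxy hxz hyz⟩

theorem exists_third_vertex {t : Finset Pt} (hc : t.card = 3) {u v : Pt} (hu : u ∈ t)
    (hv : v ∈ t) (huv : u ≠ v) : ∃ w, t = {u, v, w} ∧ u ≠ w ∧ v ≠ w := by
  obtain ⟨x, y, z, hxy, hxz, hyz, rfl⟩ := Finset.card_eq_three.1 hc
  have h : ({u, v} : Finset Pt) ⊆ {x, y, z} := by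
    simp [Finset.insert_subset_iff] at hu hv ⊢; exact ⟨hu, hv⟩
  have h1 : (({x, y, z} : Finset Pt) \ {u, v}).card = 1 := by
    rw [Finset.card_sdiff_of_subset h, hc, Finset.card_pair huv]
  obtain ⟨w, hw⟩ := Finset.card_eq_one.1 h1
  have hwm : w ∈ ({x, y, z} : Finset Pt) \ {u, v} := by rw [hw]; simp
  simp only [Finset.mem_sdiff, Finset.mem_insert, Finset.mem_singleton, not_or] at hwm
  refine ⟨w, ?_, Ne.symm hwm.2.1, Ne.symm hwm.2.2⟩
  rw [← Finset.sdiff_union_of_subset h, hw]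
  ext p; simp; tauto

theorem exists_other_vertices {t : Finset Pt} (hc : t.card = 3) {p : Pt} (hp : p ∈ t) :
    ∃ x y, t = {p, x, y} ∧ p ≠ x ∧ p ≠ y ∧ x ≠ y := by
  obtain ⟨x, hx, hxp⟩ := Finset.exists_mem_ne (s := t) (by omega) p
  obtain ⟨y, h1, h2, h3⟩ := exists_third_vertex hc hp hx hxp.symm
  exact ⟨x, y, h1, hxp.symm, h2, h3⟩

theorem GenPos.closure_interior_triSet {P : Set Pt} (hgp : GenPos P) {t : Finset Pt}
    (hc : t.card = 3) (ht : (t : Set Pt) ⊆ P) : closure (interior (triSet t)) = triSet t := by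
  obtain ⟨x, y, z, rfl, -, -, -, -, -, -, h⟩ := hgp.exists_triple hc ht
  have hne : (interior (triSet {x, y, z})).Nonempty :=
    ⟨_, (mem_interior_triSet h).2 ⟨1 / 3, 1 / 3, 1 / 3, by norm_num, by norm_num, by norm_num,
      by norm_num, rfl⟩⟩
  have hconv : Convex ℝ (triSet {x, y, z}) := convex_convexHull ℝ _
  rw [hconv.closure_interior_eq_closure_of_nonempty_interior hne]
  exact (isClosed_triSet _).closure_eq

/-! ### Triangulations -/

section Triangulation

variable {P : Set Pt} {T : Set (Finset Pt)}

theorem IsTriangulation.eq_of_mem_interior (hT : IsTriangulation P T) (hgp : GenPos P)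
    {t s : Finset Pt} (ht : t ∈ T) (hs : s ∈ T) {w : Pt} (hwt : w ∈ interior (triSet t))
    (hws : w ∈ triSet s) : t = s := by
  by_contra hne
  have hcl : w ∈ closure (interior (triSet s)) := by
    rwa [hgp.closure_interior_triSet (hT.2.1 s hs).1 (hT.2.1 s hs).2]
  obtain ⟨q, hq⟩ := mem_closure_iff.1 hcl _ isOpen_interior hwt
  have hemp : interior (triSet t) ∩ interior (triSet s) = ∅ := hT.2.2.2.1 ht hs hne
  rw [hemp] at hq
  exact hq

theorem IsTriangulation.vertex_of_mem (hT : IsTriangulation P T) (hgp : GenPos P)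
    {t : Finset Pt} (ht : t ∈ T) {q : Pt} (hq : q ∈ P) (hqt : q ∈ triSet t) : q ∈ t := by
  obtain ⟨s, hs, hqs⟩ := hT.2.2.1 q hq
  by_contra hne
  obtain ⟨x, y, z, rfl, hx, hy, hz, hxy, hxz, hyz, hcr⟩ :=
    hgp.exists_triple (hT.2.1 t ht).1 (hT.2.1 t ht).2
  simp only [Finset.mem_insert, Finset.mem_singleton, not_or] at hne
  obtain ⟨α, β, γ, hα, hβ, hγ, hsum, hw⟩ := mem_triSet.1 hqt
  have h1 : cr y z q = α * cr x y z := by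
    rw [hw, cr_comb _ _ _ _ _ hsum, cr_left, cr_right, cr_rotate]; ring
  have h2 : cr z x q = β * cr x y z := by
    rw [hw, cr_comb _ _ _ _ _ hsum, cr_left, cr_right, cr_rotate y z x, cr_rotate]; ring
  have h3 : cr x y q = γ * cr x y z := by
    rw [hw, cr_comb _ _ _ _ _ hsum, cr_left, cr_right]; ring
  have hα' : α ≠ 0 := fun h => hgp.cr_ne_zero hy hz hq hyz (Ne.symm hne.2.1) (Ne.symm hne.2.2)
    (by rw [h1, h, zero_mul])
  have hβ' : β ≠ 0 := fun h => hgp.cr_ne_zero hz hx hq hxz.symm (Ne.symm hne.2.2) (Ne.symm hne.1)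
    (by rw [h2, h, zero_mul])
  have hγ' : γ ≠ 0 := fun h => hgp.cr_ne_zero hx hy hq hxy (Ne.symm hne.1) (Ne.symm hne.2.1)
    (by rw [h3, h, zero_mul])
  have hint : q ∈ interior (triSet {x, y, z}) :=
    (mem_interior_triSet hcr).2 ⟨α, β, γ, hα.lt_of_ne' hα', hβ.lt_of_ne' hβ', hγ.lt_of_ne' hγ',
      hsum, hw⟩
  have := hT.eq_of_mem_interior hgp ht hs hint (subset_convexHull ℝ _ hqs)
  rw [← this] at hqs
  simp only [Finset.mem_insert, Finset.mem_singleton] at hqs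
  tauto

/-- Two triangles of a triangulation with a common side, on the same side of it, are equal. -/
theorem IsTriangulation.eq_of_same_side (hT : IsTriangulation P T) (hgp : GenPos P)
    {u v a b : Pt} (ha : ({u, v, a} : Finset Pt) ∈ T) (hb : ({u, v, b} : Finset Pt) ∈ T)
    (h : 0 < cr u v a * cr u v b) : a = b := by
  have hca : cr u v a ≠ 0 := left_ne_zero_of_mul h.ne'
  have hcb : cr u v b ≠ 0 := right_ne_zero_of_mul h.ne'
  obtain ⟨α, β, γ, hsum, hab⟩ := exists_barycentric hcb a
  have hγ : cr u v a = γ * cr u v b := by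
    rw [hab, cr_comb _ _ _ _ _ hsum, cr_left, cr_right]; ring
  have hγ' : 0 < γ := by
    rw [hγ, mul_assoc] at h
    exact pos_of_mul_pos_left h (mul_self_nonneg _)
  set ε : ℝ := 1 / (2 * (1 + |α| + |β|)) with hε
  have hA := abs_nonneg α
  have hB := abs_nonneg β
  have hε0 : 0 < ε := by positivity
  have hε1 : ε * (1 + |α| + |β|) = 1 / 2 := by rw [hε]; field_simp
  have hεα : -(ε * |α|) ≤ ε * α := by nlinarith [neg_abs_le α]
  have hεβ : -(ε * |β|) ≤ ε * β := by nlinarith [neg_abs_le β]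
  have p1 := mul_nonneg hε0.le hA
  have p2 := mul_nonneg hε0.le hB
  have h1 : ((1 - ε) / 2) • u + ((1 - ε) / 2) • v + ε • a ∈ interior (triSet {u, v, a}) :=
    (mem_interior_triSet hca).2 ⟨_, _, _, by nlinarith, by nlinarith, hε0, by ring, rfl⟩
  have h2 : ((1 - ε) / 2) • u + ((1 - ε) / 2) • v + ε • a ∈ triSet {u, v, b} := by
    refine mem_triSet.2 ⟨(1 - ε) / 2 + ε * α, (1 - ε) / 2 + ε * β, ε * γ, by nlinarith,
      by nlinarith, by positivity, by linear_combination ε * hsum, ?_⟩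
    rw [hab]; module
  have heq := hT.eq_of_mem_interior hgp ha hb h1 h2
  have : a ∈ ({u, v, b} : Finset Pt) := heq ▸ (by simp)
  simp only [Finset.mem_insert, Finset.mem_singleton] at this
  rcases this with rfl | rfl | rfl
  · simp [cr_left] at hca
  · simp [cr_right] at hca
  · rfl

/-- The triangle of a triangulation at a vertex `p` in the direction of `m`. -/
theorem IsTriangulation.exists_toward (hT : IsTriangulation P T) (hgp : GenPos P) {p m : Pt}
    (hp : p ∈ P) (hm : m ∈ convexHull ℝ P) :
    ∃ x y, ({p, x, y} : Finset Pt) ∈ T ∧ p ≠ x ∧ p ≠ y ∧ x ≠ y ∧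
      ∃ s t : ℝ, 0 ≤ s ∧ 0 ≤ t ∧ m = (1 - s - t) • p + s • x + t • y := by
  set F : Set Pt := ⋃ t ∈ {t ∈ T | p ∉ t}, triSet t with hF
  have hFc : IsClosed F :=
    (hT.1.subset (Set.sep_subset _ _)).isClosed_biUnion fun t _ => isClosed_triSet t
  have hpF : p ∉ F := by
    simp only [hF, mem_iUnion, not_exists]
    exact fun t ht hpt => ht.2 (hT.vertex_of_mem hgp ht.1 hp hpt)
  have hcont : Continuous fun ε : ℝ => (1 - ε) • p + ε • m := by fun_prop
  have hopen : IsOpen ((fun ε : ℝ => (1 - ε) • p + ε • m) ⁻¹' Fᶜ) := hFc.isOpen_compl.preimage hcont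
  obtain ⟨δ, hδ, hball⟩ := Metric.isOpen_iff.1 hopen 0 (by simpa using hpF)
  set ε := min (δ / 2) 1 with hε
  have hε0 : 0 < ε := lt_min (by linarith) one_pos
  have hε1 : ε ≤ 1 := min_le_right _ _
  have hmem : (1 - ε) • p + ε • m ∉ F := hball (by
    rw [Metric.mem_ball, dist_zero_right, Real.norm_of_nonneg hε0.le]
    exact (min_le_left _ _).trans_lt (by linarith))
  have hhull : (1 - ε) • p + ε • m ∈ convexHull ℝ P :=
    convex_convexHull ℝ P (subset_convexHull ℝ P hp) hm (by linarith) hε0.le (by ring)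
  rw [← hT.2.2.2.2] at hhull
  simp only [mem_iUnion] at hhull
  obtain ⟨t, ht, hwt⟩ := hhull
  have hpt : p ∈ t := by
    by_contra hpt
    exact hmem (by simp only [hF, mem_iUnion]; exact ⟨t, ⟨ht, hpt⟩, hwt⟩)
  obtain ⟨x, y, rfl, hpx, hpy, hxy⟩ := exists_other_vertices (hT.2.1 t ht).1 hpt
  obtain ⟨α, β, γ, hα, hβ, hγ, hsum, hw⟩ := mem_triSet.1 hwt
  refine ⟨x, y, ht, hpx, hpy, hxy, β / ε, γ / ε, by positivity, by positivity, ?_⟩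
  have hm' : m = (1 / ε) • (((1 - ε) • p + ε • m) - (1 - ε) • p) := by
    rw [add_sub_cancel_left, smul_smul, one_div, inv_mul_cancel₀ hε0.ne', one_smul]
  rw [hm', hw]
  obtain rfl : α = 1 - β - γ := by linarith
  match_scalars <;> field_simp
  ring

end Triangulation

/-! ### Existence of the Delaunay triangulation -/

/-- The triangles with vertices in `P` whose open circumdisk contains no point of `P`. -/
def emptyTriangles (P : Set Pt) : Set (Finset Pt) :=
  {t | t.card = 3 ∧ (t : Set Pt) ⊆ P ∧
    ∃ f, IsCircleFun f ∧ (∀ p ∈ t, f p = 0) ∧ ∀ p ∈ P, 0 ≤ f p}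

theorem exists_pivot {α β γ a b c : ℝ} (hα : 0 < α) (hβ : 0 < β) (hγ : 0 < γ)
    (h : a + b + c = 1) :
    ∃ θ, 0 < θ ∧ 0 ≤ α - θ * a ∧ 0 ≤ β - θ * b ∧ 0 ≤ γ - θ * c ∧
      (α - θ * a = 0 ∨ β - θ * b = 0 ∨ γ - θ * c = 0) := by
  set M := max (a / α) (max (b / β) (c / γ)) with hM
  have ha : a ≤ M * α := (div_le_iff₀ hα).1 (le_max_left _ _)
  have hb : b ≤ M * β := (div_le_iff₀ hβ).1 ((le_max_left _ _).trans (le_max_right _ _))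
  have hc : c ≤ M * γ := (div_le_iff₀ hγ).1 ((le_max_right _ _).trans (le_max_right _ _))
  have hM0 : 0 < M := by
    by_contra! hle
    nlinarith [mul_nonneg (neg_nonneg.2 hle) hα.le, mul_nonneg (neg_nonneg.2 hle) hβ.le,
      mul_nonneg (neg_nonneg.2 hle) hγ.le]
  have key : ∀ {l m : ℝ}, m ≤ M * l → 0 ≤ l - M⁻¹ * m := fun {l m} hm => by
    have := mul_le_mul_of_nonneg_left hm (inv_nonneg.2 hM0.le)
    rw [inv_mul_cancel_left₀ hM0.ne'] at this
    linarith
  have key' : ∀ {l m : ℝ}, 0 < l → M = m / l → l - M⁻¹ * m = 0 := fun {l m} hl hm => by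
    have : m = M * l := by rw [hm]; field_simp
    rw [this, inv_mul_cancel_left₀ hM0.ne', sub_self]
  refine ⟨M⁻¹, inv_pos.2 hM0, key ha, key hb, key hc, ?_⟩
  rcases max_choice (a / α) (max (b / β) (c / γ)) with h1 | h1
  · exact Or.inl (key' hα (hM.trans h1))
  · rcases max_choice (b / β) (c / γ) with h2 | h2
    · exact Or.inr (Or.inl (key' hβ (hM.trans (h1.trans h2))))
    · exact Or.inr (Or.inr (key' hγ (hM.trans (h1.trans h2))))

theorem IsCircleFun.lt_of_comb {f g : Pt → ℝ} (hf : IsCircleFun f) (hg : IsCircleFun g)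
    {q y z : Pt} {θ β γ : ℝ} (hθ : 0 < θ) (h : θ + β + γ = 1) (hq : f q < 0) (hy : f y = 0)
    (hz : f z = 0) (gq : g q = 0) (gy : g y = 0) (gz : g z = 0) :
    f (θ • q + β • y + γ • z) < g (θ • q + β • y + γ • z) := by
  have := hf.sub_comb hg q y z h
  rw [hy, hz, gq, gy, gz] at this
  nlinarith [mul_pos hθ (neg_pos.2 hq)]

/-- If the circumdisk of `xyz` contains `q`, any point inside `xyz` lies in a triangle with
vertex `q` on which the circle function is larger. -/
theorem exists_improved_triangle {P : Set Pt} {f : Pt → ℝ} (hf : IsCircleFun f)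
    {x y z q w : Pt} (hx : x ∈ P) (hy : y ∈ P) (hz : z ∈ P) (hq : q ∈ P) (hxy : x ≠ y)
    (hxz : x ≠ z) (hyz : y ≠ z) (hcr : cr x y z ≠ 0) (fx : f x = 0) (fy : f y = 0)
    (fz : f z = 0) (fq : f q < 0) {α β γ : ℝ} (hα : 0 < α) (hβ : 0 < β) (hγ : 0 < γ)
    (hsum : α + β + γ = 1) (hw : w = α • x + β • y + γ • z) :
    ∃ t : Finset Pt, t.card = 3 ∧ (t : Set Pt) ⊆ P ∧ w ∈ triSet t ∧
      ∀ g, IsCircleFun g → (∀ p ∈ t, g p = 0) → f w < g w := by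
  have main : ∀ {y z : Pt} {θ β γ : ℝ}, y ∈ P → z ∈ P → y ≠ z → f y = 0 → f z = 0 → 0 < θ →
      0 ≤ β → 0 ≤ γ → θ + β + γ = 1 → w = θ • q + β • y + γ • z →
      ∃ t : Finset Pt, t.card = 3 ∧ (t : Set Pt) ⊆ P ∧ w ∈ triSet t ∧
        ∀ g, IsCircleFun g → (∀ p ∈ t, g p = 0) → f w < g w := by
    intro y z θ β γ hy hz hyz fy fz hθ hβ hγ hsum hw
    have hqy : q ≠ y := by rintro rfl; linarith
    have hqz : q ≠ z := by rintro rfl; linarith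
    refine ⟨{q, y, z}, Finset.card_eq_three.2 ⟨q, y, z, hqy, hqz, hyz, rfl⟩, ?_,
      mem_triSet.2 ⟨θ, β, γ, hθ.le, hβ, hγ, hsum, hw⟩, fun g hg h0 => ?_⟩
    · intro p hp
      simp only [Finset.coe_insert, Finset.coe_singleton, mem_insert_iff, mem_singleton_iff] at hp
      rcases hp with rfl | rfl | rfl <;> assumption
    · rw [hw]
      exact hf.lt_of_comb hg hθ hsum fq fy fz (h0 _ (by simp)) (h0 _ (by simp)) (h0 _ (by simp))
  obtain ⟨a, b, c, habc, hqc⟩ := exists_barycentric hcr q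
  obtain ⟨θ, hθ, h1, h2, h3, h0⟩ := exists_pivot hα hβ hγ habc
  have hw' : w = θ • q + (α - θ * a) • x + (β - θ * b) • y + (γ - θ * c) • z := by
    rw [hw, hqc]; module
  have hs : θ + (α - θ * a) + (β - θ * b) + (γ - θ * c) = 1 := by
    linear_combination hsum - θ * habc
  rcases h0 with h0 | h0 | h0
  · exact main hy hz hyz fy fz hθ h2 h3 (by linarith) (by rw [hw', h0]; module)
  · exact main hx hz hxz fx fz hθ h1 h3 (by linarith) (by rw [hw', h0]; module)
  · exact main hx hy hxy fx fy hθ h1 h2 (by linarith) (by rw [hw', h0]; module)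

theorem exists_triangle_of_generic {P : Set Pt} (hP : P.Nontrivial) {w : Pt}
    (hw : w ∈ convexHull ℝ P) (hgen : ∀ x ∈ P, ∀ y ∈ P, x ≠ y → cr x y w ≠ 0) :
    ∃ t : Finset Pt, t.card = 3 ∧ (t : Set Pt) ⊆ P ∧ w ∈ triSet t := by
  rw [convexHull_eq_union] at hw
  simp only [mem_iUnion] at hw
  obtain ⟨t, htP, hind, hwt⟩ := hw
  refine ⟨t, ?_, htP, hwt⟩
  have hle : t.card ≤ 3 := by
    have := hind.card_le_finrank_succ.trans
      (Nat.succ_le_succ (Submodule.finrank_le (vectorSpan ℝ (range ((↑) : t → Pt)))))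
    simpa using this
  by_contra hne
  interval_cases hcard : t.card
  · rw [Finset.card_eq_zero] at hcard
    subst hcard
    simp at hwt
  · obtain ⟨x, rfl⟩ := Finset.card_eq_one.1 hcard
    simp only [Finset.coe_singleton, convexHull_singleton, mem_singleton_iff] at hwt
    subst hwt
    have hwP : w ∈ P := htP (by simp)
    obtain ⟨y, hy, hyw⟩ := hP.exists_ne w
    exact hgen w hwP y hy hyw.symm (cr_left w y)
  · obtain ⟨x, y, hxy, rfl⟩ := Finset.card_eq_two.1 hcard
    simp only [Finset.coe_insert, Finset.coe_singleton, convexHull_pair] at hwt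
    obtain ⟨a, b, -, -, hab, rfl⟩ := hwt
    refine hgen x (htP (by simp)) y (htP (by simp)) hxy ?_
    rw [cr_comb₂ _ _ _ _ hab, cr_left, cr_right]; ring
  · exact hne rfl

theorem exists_emptyTriangle_of_generic {P : Set Pt} (hfin : P.Finite) (hgp : GenPos P)
    (hP : P.Nontrivial) {w : Pt} (hw : w ∈ convexHull ℝ P)
    (hgen : ∀ x ∈ P, ∀ y ∈ P, x ≠ y → cr x y w ≠ 0) :
    ∃ t ∈ emptyTriangles P, w ∈ triSet t := by
  have hex : ∀ t : Finset Pt, t.card = 3 → (t : Set Pt) ⊆ P →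
      ∃ f, IsCircleFun f ∧ ∀ p ∈ t, f p = 0 := by
    intro t hc ht
    obtain ⟨x, y, z, rfl, -, -, -, -, -, -, h⟩ := hgp.exists_triple hc ht
    obtain ⟨f, hf, hx, hy, hz⟩ := exists_circleFun h
    exact ⟨f, hf, by simp [hx, hy, hz]⟩
  choose! F hF hF0 using hex
  have hS : {t : Finset Pt | t.card = 3 ∧ (t : Set Pt) ⊆ P ∧ w ∈ triSet t}.Finite := by
    refine (hfin.toFinset.powerset.finite_toSet).subset fun t ht => ?_
    simp only [Finset.coe_powerset, mem_preimage, mem_powerset_iff, Finite.coe_toFinset]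
    exact ht.2.1
  obtain ⟨t, ⟨hc, htP, hwt⟩, hmax⟩ := Set.exists_max_image _ (fun t => F t w) hS
    (exists_triangle_of_generic hP hw hgen)
  refine ⟨t, ⟨hc, htP, F t, hF t hc htP, hF0 t hc htP, fun q hq => ?_⟩, hwt⟩
  by_contra! hneg
  have h0 := hF0 t hc htP
  have hFt := hF t hc htP
  obtain ⟨x, y, z, rfl, hx, hy, hz, hxy, hxz, hyz, hcr⟩ := hgp.exists_triple hc htP
  obtain ⟨α, β, γ, hα, hβ, hγ, hsum, hwc⟩ := mem_triSet.1 hwt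
  have hα' : α ≠ 0 := fun h => hgen y hy z hz hyz (by
    rw [hwc, cr_comb _ _ _ _ _ hsum, cr_left, cr_right, h]; ring)
  have hβ' : β ≠ 0 := fun h => hgen x hx z hz hxz (by
    rw [hwc, cr_comb _ _ _ _ _ hsum, cr_left, cr_right, h]; ring)
  have hγ' : γ ≠ 0 := fun h => hgen x hx y hy hxy (by
    rw [hwc, cr_comb _ _ _ _ _ hsum, cr_left, cr_right, h]; ring)
  obtain ⟨s, hsc, hsP, hws, hlt⟩ := exists_improved_triangle hFt hx hy hz hq hxy hxz hyz hcr
    (h0 x (by simp)) (h0 y (by simp)) (h0 z (by simp)) hneg (hα.lt_of_ne' hα')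
    (hβ.lt_of_ne' hβ') (hγ.lt_of_ne' hγ') hsum hwc
  exact (hlt _ (hF s hsc hsP) (hF0 s hsc hsP)).not_ge (hmax s ⟨hsc, hsP, hws⟩)

theorem dense_generic {P : Set Pt} (hfin : P.Finite) :
    Dense {w : Pt | ∀ x ∈ P, ∀ y ∈ P, x ≠ y → cr x y w ≠ 0} := by
  have hline : ∀ x y : Pt, x ≠ y → ∀ᵐ w : Pt, cr x y w ≠ 0 := by
    intro x y hxy
    rw [MeasureTheory.ae_iff]
    refine MeasureTheory.measure_mono_null (t := (line[ℝ, x, y] : Set Pt)) ?_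
      (MeasureTheory.Measure.addHaar_affineSubspace _ _ ?_)
    · intro w hw
      have hcol := collinear_of_cr_eq_zero hxy (not_not.1 hw)
      exact hcol.mem_affineSpan_of_mem_of_ne (by simp) (by simp) (by simp) hxy
    · intro htop
      have := (collinear_pair ℝ x y).finrank_le_one
      rw [← direction_affineSpan, htop, AffineSubspace.direction_top, finrank_top] at this
      simp at this
  have : ∀ᵐ w : Pt, ∀ x ∈ P, ∀ y ∈ P, x ≠ y → cr x y w ≠ 0 := by
    rw [MeasureTheory.ae_ball_iff hfin.countable]
    intro x _
    rw [MeasureTheory.ae_ball_iff hfin.countable]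
    intro y _
    by_cases hxy : x = y
    · simp [hxy]
    · simpa [hxy] using hline x y hxy
  exact MeasureTheory.Measure.dense_of_ae this

theorem emptyTriangles_finite {P : Set Pt} (hfin : P.Finite) : (emptyTriangles P).Finite := by
  refine (hfin.toFinset.powerset.finite_toSet).subset fun t ht => ?_
  simp only [Finset.coe_powerset, mem_preimage, mem_powerset_iff, Finite.coe_toFinset]
  exact ht.2.1

theorem iUnion_emptyTriangles {P : Set Pt} (hfin : P.Finite) (hgp : GenPos P) {a b c : Pt}
    (ha : a ∈ P) (hb : b ∈ P) (hc : c ∈ P) (hcr : cr a b c ≠ 0) :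
    (⋃ t ∈ emptyTriangles P, triSet t) = convexHull ℝ P := by
  have hab : a ≠ b := by rintro rfl; simp [cr] at hcr
  refine Subset.antisymm (iUnion₂_subset fun t ht => convexHull_mono ht.2.1) ?_
  have hclosed : IsClosed (⋃ t ∈ emptyTriangles P, triSet t) :=
    (emptyTriangles_finite hfin).isClosed_biUnion fun t _ => isClosed_triSet t
  have hne : (interior (convexHull ℝ P)).Nonempty := by
    have hsub : triSet {a, b, c} ⊆ convexHull ℝ P := convexHull_mono (by
      simp [Set.insert_subset_iff, ha, hb, hc])
    exact ⟨_, interior_mono hsub ((mem_interior_triSet hcr).2 ⟨1 / 3, 1 / 3, 1 / 3, by norm_num,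
      by norm_num, by norm_num, by norm_num, rfl⟩)⟩
  calc convexHull ℝ P ⊆ closure (convexHull ℝ P) := subset_closure
    _ = closure (interior (convexHull ℝ P)) :=
      ((convex_convexHull ℝ P).closure_interior_eq_closure_of_nonempty_interior hne).symm
    _ ⊆ ⋃ t ∈ emptyTriangles P, triSet t := by
      refine closure_minimal ?_ hclosed
      refine ((dense_generic hfin).open_subset_closure_inter isOpen_interior).trans
        (closure_minimal ?_ hclosed)
      rintro w ⟨hw, hgen⟩
      obtain ⟨t, ht, hwt⟩ := exists_emptyTriangle_of_generic hfin hgp ⟨a, ha, b, hb, hab⟩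
        (interior_subset hw) hgen
      exact mem_biUnion ht hwt

theorem emptyTriangles_eq_of_mem_interior {P : Set Pt} (hgp : GenPos P) {t s : Finset Pt}
    (ht : t ∈ emptyTriangles P) (hs : s ∈ emptyTriangles P) {w : Pt}
    (hwt : w ∈ interior (triSet t)) (hws : w ∈ triSet s) : t = s := by
  obtain ⟨htc, htP, f, hf, hft, hfP⟩ := ht
  obtain ⟨hsc, hsP, g, hg, hgs, hgP⟩ := hs
  obtain ⟨x, y, z, rfl, hx, hy, hz, hxy, hxz, hyz, hcr⟩ := hgp.exists_triple htc htP
  obtain ⟨x', y', z', rfl, hx', hy', hz', hxy', hxz', hyz', -⟩ := hgp.exists_triple hsc hsP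
  obtain ⟨α, β, γ, hα, hβ, hγ, hsum, hw⟩ := (mem_interior_triSet hcr).1 hwt
  obtain ⟨α', β', γ', hα', hβ', hγ', hsum', hw'⟩ := mem_triSet.1 hws
  have h1 := hf.sub_comb hg x y z hsum
  have h2 := hf.sub_comb hg x' y' z' hsum'
  rw [← hw] at h1
  rw [← hw'] at h2
  simp only [Finset.mem_insert, Finset.mem_singleton, forall_eq_or_imp, forall_eq] at hft hgs
  rw [hft.1, hft.2.1, hft.2.2] at h1
  rw [hgs.1, hgs.2.1, hgs.2.2] at h2
  have gx := hgP x hx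
  have gy := hgP y hy
  have gz := hgP z hz
  have h3 := mul_nonneg hα' (hfP x' hx')
  have h4 := mul_nonneg hβ' (hfP y' hy')
  have h5 := mul_nonneg hγ' (hfP z' hz')
  have h6 := mul_nonneg hα.le gx
  have h7 := mul_nonneg hβ.le gy
  have h8 := mul_nonneg hγ.le gz
  have gx0 : g x = 0 := (mul_eq_zero.1 (show α * g x = 0 by linarith)).resolve_left hα.ne'
  have gy0 : g y = 0 := (mul_eq_zero.1 (show β * g y = 0 by linarith)).resolve_left hβ.ne'
  have gz0 : g z = 0 := (mul_eq_zero.1 (show γ * g z = 0 by linarith)).resolve_left hγ.ne'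
  refine Finset.eq_of_subset_of_card_le (fun p hp => ?_) (by rw [htc, hsc])
  have key := fun p (hp : p ∈ P) (h0 : g p = 0) => hgp.not_concyclic hg hx' hy' hz' hp hxy' hxz'
    hyz' hgs.1 hgs.2.1 hgs.2.2 h0
  simp only [Finset.mem_insert, Finset.mem_singleton] at hp ⊢
  rcases hp with rfl | rfl | rfl
  · exact key _ hx gx0
  · exact key _ hy gy0
  · exact key _ hz gz0

theorem isOrderDT_emptyTriangles {P : Set Pt} (hfin : P.Finite) (hgp : GenPos P) {a b c : Pt}
    (ha : a ∈ P) (hb : b ∈ P) (hc : c ∈ P) (hcr : cr a b c ≠ 0) :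
    IsOrderDT P 0 (emptyTriangles P) := by
  have hcover := iUnion_emptyTriangles hfin hgp ha hb hc hcr
  refine ⟨⟨emptyTriangles_finite hfin, fun t ht => ⟨ht.1, ht.2.1⟩, fun p hp => ?_,
    fun t ht s hs hts => ?_, hcover⟩, fun t ht => ?_⟩
  · have hp' := subset_convexHull ℝ P hp
    rw [← hcover] at hp'
    simp only [mem_iUnion] at hp'
    obtain ⟨t, ht, hpt⟩ := hp'
    refine ⟨t, ht, ?_⟩
    obtain ⟨htc, htP, f, hf, hft, hfP⟩ := ht
    obtain ⟨x, y, z, rfl, hx, hy, hz, hxy, hxz, hyz, -⟩ := hgp.exists_triple htc htP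
    obtain ⟨α, β, γ, hα, hβ, hγ, hsum, hw⟩ := mem_triSet.1 hpt
    simp only [Finset.mem_insert, Finset.mem_singleton, forall_eq_or_imp, forall_eq] at hft ⊢
    obtain ⟨g, hg, hgle⟩ : ∃ g : Pt → ℝ, IsCircleFun g ∧ g p = 0 ∧ 0 ≤ g x ∧ 0 ≤ g y ∧ 0 ≤ g z :=
      ⟨_, isCircleFun_dist p 0, by simp, by simp, by simp, by simp⟩
    have h := hf.sub_comb hg x y z hsum
    rw [← hw, hft.1, hft.2.1, hft.2.2, hgle.1] at h
    have h1 := mul_nonneg hα hgle.2.1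
    have h2 := mul_nonneg hβ hgle.2.2.1
    have h3 := mul_nonneg hγ hgle.2.2.2
    exact hgp.not_concyclic hf hx hy hz hp hxy hxz hyz hft.1 hft.2.1 hft.2.2
      (le_antisymm (by linarith) (hfP p hp))
  · refine not_nonempty_iff_eq_empty.1 ?_
    rintro ⟨w, hwt, hws⟩
    exact hts (emptyTriangles_eq_of_mem_interior hgp ht hs hwt (interior_subset hws))
  · obtain ⟨htc, htP, f, hf, hft, hfP⟩ := ht
    refine (orderKTri_iff (Finset.card_pos.1 (by omega))).2 ⟨f, hf, hft, ?_⟩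
    have : {p ∈ P | f p < 0} = ∅ := by
      ext p
      simp only [mem_sep_iff, mem_empty_iff_false, iff_false, not_and, not_lt]
      exact hfP p
    simp [this]

/-! ### Triangles of order-1 Delaunay triangulations -/

/-- A point of the line `xy` at which a circle function is nonpositive lies on the segment `xy`
as soon as the disk meets the open segment and contains neither `x` nor `y`. -/
theorem IsCircleFun.nonneg_of_nonpos {f : Pt → ℝ} (hf : IsCircleFun f) {x y : Pt}
    (hx : 0 ≤ f x) (hy : 0 ≤ f y) {a b c d : ℝ} (hab : a + b = 1) (ha : 0 < a) (hb : 0 < b)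
    (hneg : f (a • x + b • y) < 0) (hcd : c + d = 1) (hle : f (c • x + d • y) ≤ 0) :
    0 ≤ c ∧ 0 ≤ d := by
  rw [hf.comb₂ x y hab] at hneg
  rw [hf.comb₂ x y hcd] at hle
  have hD := sq_nonneg (dist x y)
  set D := dist x y ^ 2
  obtain rfl : b = 1 - a := by linarith
  obtain rfl : d = 1 - c := by linarith
  constructor
  · by_contra! hc
    have h1 : a * (c * f x + (1 - c) * f y - c * (1 - c) * D) -
        c * (a * f x + (1 - a) * f y - a * (1 - a) * D) =
        (a - c) * f y + D * (a * (c * (c - a))) := by ring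
    have h2 : 0 ≤ D * (a * (c * (c - a))) :=
      mul_nonneg hD (mul_nonneg ha.le (mul_nonneg_of_nonpos_of_nonpos hc.le (by linarith)))
    have h3 : 0 ≤ (a - c) * f y := mul_nonneg (by linarith) hy
    have h4 := mul_nonneg ha.le (neg_nonneg.2 hle)
    have h5 := mul_pos_of_neg_of_neg hc hneg
    linarith
  · by_contra! hc
    have h1 : (1 - a) * (c * f x + (1 - c) * f y - c * (1 - c) * D) -
        (1 - c) * (a * f x + (1 - a) * f y - a * (1 - a) * D) =
        (c - a) * f x + D * ((1 - a) * ((1 - c) * (a - c))) := by ring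
    have h2 : 0 ≤ D * ((1 - a) * ((1 - c) * (a - c))) :=
      mul_nonneg hD (mul_nonneg hb.le (mul_nonneg_of_nonpos_of_nonpos hc.le (by linarith)))
    have h3 : 0 ≤ (c - a) * f x := mul_nonneg (by linarith) hx
    have h4 := mul_nonneg hb.le (neg_nonneg.2 hle)
    have h5 := mul_pos_of_neg_of_neg hc hneg
    linarith

theorem IsCircleFun.comb₂_neg {f : Pt → ℝ} (hf : IsCircleFun f) {x y : Pt} {a b : ℝ}
    (h : a + b = 1) (ha : 0 < a) (hb : 0 ≤ b) (hx : f x < 0) (hy : f y ≤ 0) :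
    f (a • x + b • y) < 0 := by
  rw [hf.comb₂ x y h]
  have h1 := mul_nonneg (mul_nonneg ha.le hb) (sq_nonneg (dist x y))
  have h2 := mul_pos ha (neg_pos.2 hx)
  have h3 := mul_nonneg hb (neg_nonneg.2 hy)
  linarith

theorem IsCircleFun.comb₂_nonpos {f : Pt → ℝ} (hf : IsCircleFun f) {x y : Pt} {a b : ℝ}
    (h : a + b = 1) (ha : 0 ≤ a) (hb : 0 ≤ b) (hx : f x ≤ 0) (hy : f y ≤ 0) :
    f (a • x + b • y) ≤ 0 := by
  rw [hf.comb₂ x y h]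
  have h1 := mul_nonneg (mul_nonneg ha hb) (sq_nonneg (dist x y))
  have h2 := mul_nonneg ha (neg_nonneg.2 hx)
  have h3 := mul_nonneg hb (neg_nonneg.2 hy)
  linarith

/-- Moving slightly from the open side `xy` of a triangle `pxy` towards a point on the side of
`p` leads into the interior of the triangle. -/
theorem exists_mem_interior_of_open_side {p x y : Pt} (hcr : cr p x y ≠ 0) {l n c a b : ℝ}
    (hl : 0 < l) (hn : 0 < n) (hln : l + n = 1) (hc : 0 < c) (hsum : c + a + b = 1) :
    ∃ ε : ℝ, 0 < ε ∧ ε ≤ 1 ∧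
      (1 - ε) • (l • x + n • y) + ε • (c • p + a • x + b • y) ∈ interior (triSet {p, x, y}) := by
  obtain ⟨r, hr0, hrl, hrn⟩ : ∃ r : ℝ, 0 < r ∧ r ≤ l ∧ r ≤ n :=
    ⟨min l n, lt_min hl hn, min_le_left _ _, min_le_right _ _⟩
  have hA := abs_nonneg a
  have hB := abs_nonneg b
  obtain ⟨ε, hε0, hε1⟩ : ∃ ε : ℝ, 0 < ε ∧ ε * (1 + |a| + |b|) = r / 2 :=
    ⟨r / (2 * (1 + |a| + |b|)), by positivity, by field_simp⟩
  have p1 := mul_nonneg hε0.le hA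
  have p2 := mul_nonneg hε0.le hB
  have q1 := mul_le_mul_of_nonneg_left (neg_abs_le a) hε0.le
  have q2 := mul_le_mul_of_nonneg_left (neg_abs_le b) hε0.le
  have hr1 : r ≤ 1 / 2 := by linarith
  have hε2 : ε ≤ 1 / 2 := by linarith
  have p3 := mul_le_mul_of_nonneg_left (show l ≤ 1 by linarith) hε0.le
  have p4 := mul_le_mul_of_nonneg_left (show n ≤ 1 by linarith) hε0.le
  refine ⟨ε, hε0, by linarith, (mem_interior_triSet hcr).2
    ⟨ε * c, (1 - ε) * l + ε * a, (1 - ε) * n + ε * b, mul_pos hε0 hc, ?_, ?_, ?_, ?_⟩⟩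
  · linarith
  · linarith
  · linear_combination ε * hsum + (1 - ε) * hln
  · module

/-- Let `p` lie in the disk of `f` and let `pxy` be a triangle with `x`, `y` outside this disk.
If `u` on the circle is visible from a point `m` of the disk beyond `xy` without entering `pxy`,
then `u` lies on or beyond `xy`. -/
theorem one_le_of_far_side {f : Pt → ℝ} (hf : IsCircleFun f)
    {p x y m u : Pt} {s t c a b : ℝ} (hcr : cr p x y ≠ 0) (fm : f m < 0) (fu : f u = 0)
    (fx : 0 ≤ f x) (fy : 0 ≤ f y) (hm : m = (1 - s - t) • p + s • x + t • y) (hst : 1 ≤ s + t)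
    (hsegment : ∀ {l n : ℝ}, l + n = 1 → f (l • x + n • y) ≤ 0 → 0 ≤ l ∧ 0 ≤ n)
    (hno : ∀ τ : ℝ, 0 ≤ τ → τ ≤ 1 → (1 - τ) • m + τ • u ∉ interior (triSet {p, x, y}))
    (hsum : c + a + b = 1) (hu : u = c • p + a • x + b • y) : 1 ≤ a + b := by
  by_contra! hlt
  have hden : 0 < s + t - (a + b) := by linarith
  obtain ⟨τ, hτ0, hτ1, hτd⟩ : ∃ τ : ℝ, 0 ≤ τ ∧ τ < 1 ∧ τ * (s + t - (a + b)) = s + t - 1 :=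
    ⟨(s + t - 1) / (s + t - (a + b)), div_nonneg (by linarith) hden.le,
      by rw [div_lt_one hden]; linarith, by field_simp⟩
  obtain ⟨l, hl⟩ : ∃ l, l = (1 - τ) * s + τ * a := ⟨_, rfl⟩
  obtain ⟨n, hn⟩ : ∃ n, n = (1 - τ) * t + τ * b := ⟨_, rfl⟩
  have hln : l + n = 1 := by rw [hl, hn]; linear_combination -hτd
  have hk : (1 - τ) • m + τ • u = l • x + n • y := by
    have hc : c = 1 - a - b := by linarith
    have h0 : (1 - τ) * (1 - s - t) + τ * (1 - a - b) = 0 := by linear_combination hτd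
    calc (1 - τ) • m + τ • u
        = ((1 - τ) * (1 - s - t) + τ * (1 - a - b)) • p + l • x + n • y := by
          rw [hm, hu, hc, hl, hn]; module
      _ = l • x + n • y := by rw [h0]; module
  have fk : f (l • x + n • y) < 0 := by
    rw [← hk]; exact hf.comb₂_neg (by ring) (by linarith) hτ0 fm fu.le
  obtain ⟨hl0, hn0⟩ := hsegment hln fk.le
  have hl0 : 0 < l := hl0.lt_of_ne' fun h => by
    rw [h, show n = 1 by linarith, zero_smul, one_smul, zero_add] at fk; linarith
  have hn0 : 0 < n := hn0.lt_of_ne' fun h => by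
    rw [h, show l = 1 by linarith, zero_smul, one_smul, add_zero] at fk; linarith
  obtain ⟨ε, hε0, hε1, hε⟩ := exists_mem_interior_of_open_side hcr hl0 hn0 hln
    (show 0 < c by linarith) hsum
  have hσ := mul_nonneg (sub_nonneg.2 hε1) (sub_nonneg.2 hτ1.le)
  refine hno ((1 - ε) * τ + ε) (add_nonneg (mul_nonneg (sub_nonneg.2 hε1) hτ0) hε0.le)
    (by linarith) ?_
  rwa [← hu, ← hk, show (1 - ε) • ((1 - τ) • m + τ • u) + ε • u =
    (1 - ((1 - ε) * τ + ε)) • m + ((1 - ε) * τ + ε) • u by module] at hε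

/-- Let `p` lie in the disk of `f` and let `pxy` be a triangle with `x`, `y` outside this disk.
If `u` on the circle is visible from a point `m` of the disk beyond `xy` without entering `pxy`,
then `u` lies in the closed circumdisk of `pxy`. -/
theorem circumdisk_mem_of_far_side {f g : Pt → ℝ} (hf : IsCircleFun f) (hg : IsCircleFun g)
    {p x y m u : Pt} {s t : ℝ} (hcr : cr p x y ≠ 0) (fp : f p < 0) (fm : f m < 0) (fu : f u = 0)
    (fx : 0 ≤ f x) (fy : 0 ≤ f y) (hm : m = (1 - s - t) • p + s • x + t • y) (hs : 0 < s)
    (ht : 0 < t) (hst : 1 ≤ s + t)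
    (hno : ∀ τ : ℝ, 0 ≤ τ → τ ≤ 1 → (1 - τ) • m + τ • u ∉ interior (triSet {p, x, y}))
    (gp : g p = 0) (gx : g x = 0) (gy : g y = 0) : g u ≤ 0 := by
  have hst0 : 0 < s + t := by linarith
  have hk₀ : f ((s / (s + t)) • x + (t / (s + t)) • y) < 0 := by
    have : (s / (s + t)) • x + (t / (s + t)) • y = (1 / (s + t)) • m + (1 - 1 / (s + t)) • p := by
      rw [hm]; match_scalars <;> field_simp; ring
    rw [this]
    exact hf.comb₂_neg (by ring) (by positivity) (by
      rw [sub_nonneg, div_le_one hst0]; exact hst) fm fp.le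
  have hsegment : ∀ {c d : ℝ}, c + d = 1 → f (c • x + d • y) ≤ 0 → 0 ≤ c ∧ 0 ≤ d :=
    fun hcd hle => hf.nonneg_of_nonpos fx fy (by field_simp) (div_pos hs hst0)
      (div_pos ht hst0) hk₀ hcd hle
  obtain ⟨c, a, b, hsum, hu⟩ := exists_barycentric hcr u
  have hab : 1 ≤ a + b := one_le_of_far_side hf hcr fm fu fx fy hm hst hsegment hno hsum hu
  have hab0 : 0 < a + b := by linarith
  obtain ⟨ha, hb⟩ : 0 ≤ a / (a + b) ∧ 0 ≤ b / (a + b) := by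
    refine hsegment (by field_simp) ?_
    have : (a / (a + b)) • x + (b / (a + b)) • y = (1 / (a + b)) • u + (1 - 1 / (a + b)) • p := by
      rw [hu, show c = 1 - a - b by linarith]; match_scalars <;> field_simp; ring
    rw [this]
    exact hf.comb₂_nonpos (by ring) (by positivity) (by
      rw [sub_nonneg, div_le_one hab0]; exact hab) fu.le fp.le
  have ha : 0 ≤ a := by rwa [le_div_iff₀ hab0, zero_mul] at ha
  have hb : 0 ≤ b := by rwa [le_div_iff₀ hab0, zero_mul] at hb
  have h := hf.sub_comb hg p x y hsum
  rw [← hu, gp, gx, gy, fu] at h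
  have h1 := mul_nonneg (show 0 ≤ -c by linarith) (neg_nonneg.2 fp.le)
  have h2 := mul_nonneg ha fx
  have h3 := mul_nonneg hb fy
  linarith

/-- If `q` lies in the circumdisk of `uvp`, opposite to `p` across `uv`, it lies in any disk
through `p` whose closure contains `u` and `v`. -/
theorem neg_of_opposite {e g : Pt → ℝ} (he : IsCircleFun e) (hg : IsCircleFun g) {u v p q : Pt}
    (hopp : cr u v p * cr u v q < 0) (eu : e u = 0) (ev : e v = 0) (ep : e p = 0) (eq : e q < 0)
    (gu : g u ≤ 0) (gv : g v ≤ 0) (gp : g p = 0) : g q < 0 := by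
  have hcr : cr u v p ≠ 0 := left_ne_zero_of_mul hopp.ne
  obtain ⟨a, b, c, hsum, hq⟩ := exists_barycentric hcr q
  have hcq : cr u v q = c * cr u v p := by
    rw [hq, cr_comb _ _ _ _ _ hsum, cr_left, cr_right]; ring
  have hc : c < 0 := by
    rw [hcq] at hopp
    nlinarith [mul_self_nonneg (cr u v p)]
  have hc1 : 0 < 1 - c := by linarith
  have hk : (a / (1 - c)) • u + (b / (1 - c)) • v = (1 / (1 - c)) • q + (-c / (1 - c)) • p := by
    rw [hq]; match_scalars <;> field_simp; ring
  obtain ⟨ha, hb⟩ := he.pos_of_neg (x := u) (y := v) (α := a / (1 - c)) (β := b / (1 - c))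
    (by rw [← add_div, div_eq_one_iff_eq hc1.ne']; linarith) eu ev (by
      rw [hk]
      exact he.comb₂_neg (by rw [← add_div, div_eq_one_iff_eq hc1.ne']; ring) (by positivity)
        (div_nonneg (by linarith) hc1.le) eq ep.le)
  have ha : 0 < a := by rwa [lt_div_iff₀ hc1, zero_mul] at ha
  have hb : 0 < b := by rwa [lt_div_iff₀ hc1, zero_mul] at hb
  have h := hg.sub_comb he u v p hsum
  rw [← hq, gp, eu, ev, ep] at h
  have h1 := mul_nonneg ha.le (neg_nonneg.2 gu)
  have h2 := mul_nonneg hb.le (neg_nonneg.2 gv)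
  linarith

section OrderOne

variable {P : Set Pt} {T : Set (Finset Pt)}

/-- Some triangle of a triangulation at `p` contains in its open angle a point of the
open segment `uv`. -/
theorem IsTriangulation.exists_toward_segment (hT : IsTriangulation P T) (hfin : P.Finite)
    (hgp : GenPos P) {p u v : Pt} (hp : p ∈ P) (hu : u ∈ P) (hv : v ∈ P) (hpu : p ≠ u)
    (hpv : p ≠ v) (huv : u ≠ v) :
    ∃ x y, ({p, x, y} : Finset Pt) ∈ T ∧ p ≠ x ∧ p ≠ y ∧ x ≠ y ∧
      ∃ σ s t : ℝ, 0 < σ ∧ σ < 1 ∧ 0 < s ∧ 0 < t ∧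
        (1 - σ) • u + σ • v = (1 - s - t) • p + s • x + t • y := by
  have hhull : ∀ σ ∈ Ioo (0 : ℝ) 1, (1 - σ) • u + σ • v ∈ convexHull ℝ P := fun σ hσ =>
    convex_convexHull ℝ P (subset_convexHull ℝ P hu) (subset_convexHull ℝ P hv)
      (by linarith [hσ.2]) hσ.1.le (by ring)
  have hex := fun σ (hσ : σ ∈ Ioo (0 : ℝ) 1) => hT.exists_toward hgp hp (hhull σ hσ)
  choose! X Y hXY hpX hpY hne S R hS hR hm using hex
  have hmaps : MapsTo (fun σ => (X σ, Y σ)) (Ioo (0 : ℝ) 1) (P ×ˢ P) := fun σ hσ =>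
    ⟨(hT.2.1 _ (hXY σ hσ)).2 (by simp), (hT.2.1 _ (hXY σ hσ)).2 (by simp)⟩
  obtain ⟨σ, hσ, ρ, hρ, hσρ, heq⟩ := (Ioo_infinite (zero_lt_one' ℝ)).exists_ne_map_eq_of_mapsTo
    hmaps (hfin.prod hfin)
  obtain ⟨hX, hY⟩ := Prod.mk.inj heq
  have hxP := (hmaps hσ).1
  have hyP := (hmaps hσ).2
  have m1 := hm σ hσ
  have m2 := hm ρ hρ
  rw [← hX, ← hY] at m2
  have hray : ∀ z ∈ P, p ≠ z → cr p z ((1 - σ) • u + σ • v) = 0 →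
      cr p z ((1 - ρ) • u + ρ • v) = 0 → False := by
    intro z hz hpz h1 h2
    rw [cr_comb₂ _ _ _ _ (by ring)] at h1 h2
    have hd : (σ - ρ) * (cr p z v - cr p z u) = 0 := by linear_combination h1 - h2
    have hd := (mul_eq_zero.1 hd).resolve_left (sub_ne_zero.2 hσρ)
    have hzu : cr p z u = 0 := by linear_combination h1 - σ * hd
    have hzv : cr p z v = 0 := by linarith
    have e1 : z = u := by
      by_contra h
      exact hgp.cr_ne_zero hp hz hu hpz hpu h hzu
    have e2 : z = v := by
      by_contra h
      exact hgp.cr_ne_zero hp hz hv hpz hpv h hzv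
    exact huv (e1.symm.trans e2)
  refine ⟨X σ, Y σ, hXY σ hσ, hpX σ hσ, hpY σ hσ, hne σ hσ, (σ + ρ) / 2, (S σ + S ρ) / 2,
    (R σ + R ρ) / 2, by linarith [hσ.1, hρ.1], by linarith [hσ.2, hρ.2], ?_, ?_, ?_⟩
  · by_contra! hle
    have z1 : S σ = 0 := by linarith [hS σ hσ, hS ρ hρ]
    have z2 : S ρ = 0 := by linarith [hS σ hσ, hS ρ hρ]
    refine hray (Y σ) hyP (hpY σ hσ) ?_ ?_
    · rw [m1, cr_comb _ _ _ _ _ (by ring), cr_left, cr_right, z1]; ring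
    · rw [m2, cr_comb _ _ _ _ _ (by ring), cr_left, cr_right, z2]; ring
  · by_contra! hle
    have z1 : R σ = 0 := by linarith [hR σ hσ, hR ρ hρ]
    have z2 : R ρ = 0 := by linarith [hR σ hσ, hR ρ hρ]
    refine hray (X σ) hxP (hpX σ hσ) ?_ ?_
    · rw [m1, cr_comb _ _ _ _ _ (by ring), cr_left, cr_right, z1]; ring
    · rw [m2, cr_comb _ _ _ _ _ (by ring), cr_left, cr_right, z2]; ring
  · calc (1 - (σ + ρ) / 2) • u + ((σ + ρ) / 2) • v
        = (1 / 2 : ℝ) • ((1 - σ) • u + σ • v) + (1 / 2 : ℝ) • ((1 - ρ) • u + ρ • v) := by module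
      _ = _ := by rw [m1, m2]; module

/-- Let `uv` be an edge of an order-1 Delaunay triangulation and let some disk through `u` and
`v` contain only the point `p`. If the circumdisk of `uvp` contains a point opposite to `p`,
then `uvp` is a triangle of the triangulation. -/
theorem IsOrderDT.triangle_mem (hT : IsOrderDT P 1 T) (hfin : P.Finite) (hgp : GenPos P)
    {u v p q : Pt} {t₀ : Finset Pt} (ht₀ : t₀ ∈ T) (hu₀ : u ∈ t₀) (hv₀ : v ∈ t₀) (hu : u ∈ P)
    (hv : v ∈ P) (hp : p ∈ P) (hq : q ∈ P) (huv : u ≠ v) {f e : Pt → ℝ} (hf : IsCircleFun f)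
    (fu : f u = 0) (fv : f v = 0) (fp : f p < 0) (hfP : ∀ z ∈ P, f z < 0 → z = p)
    (he : IsCircleFun e) (eu : e u = 0) (ev : e v = 0) (ep : e p = 0) (eq : e q < 0)
    (hopp : cr u v p * cr u v q < 0) : ({u, v, p} : Finset Pt) ∈ T := by
  have hpu : p ≠ u := by rintro rfl; linarith
  have hpv : p ≠ v := by rintro rfl; linarith
  have huq : u ≠ q := by rintro rfl; linarith
  have hvq : v ≠ q := by rintro rfl; linarith
  obtain ⟨x, y, hxy, hpx, hpy, hne, σ, s, t, hσ0, hσ1, hs, ht, hm⟩ :=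
    hT.1.exists_toward_segment hfin hgp hp hu hv hpu hpv huv
  have hsub := (hT.1.2.1 _ hxy).2
  have hx : x ∈ P := hsub (by simp)
  have hy : y ∈ P := hsub (by simp)
  have hcr : cr p x y ≠ 0 := hgp.cr_ne_zero hp hx hy hpx hpy hne
  by_contra hnot
  have hside : ¬ ((u = x ∨ u = y) ∧ (v = x ∨ v = y)) := by
    rintro ⟨h1, h2⟩
    apply hnot
    convert hxy using 1
    ext z
    simp only [Finset.mem_insert, Finset.mem_singleton]
    rcases h1 with rfl | rfl <;> rcases h2 with rfl | rfl <;> first | exact absurd rfl huv | tauto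
  have hno : ∀ τ : ℝ, 0 ≤ τ → τ ≤ 1 →
      (1 - τ) • u + τ • v ∉ interior (triSet {p, x, y}) := by
    intro τ h0 h1 hmem
    have hmem₀ : (1 - τ) • u + τ • v ∈ triSet t₀ :=
      convex_convexHull ℝ _ (subset_convexHull ℝ _ hu₀) (subset_convexHull ℝ _ hv₀)
        (by linarith) h0 (by ring)
    have := hT.1.eq_of_mem_interior hgp hxy ht₀ hmem hmem₀
    rw [← this] at hu₀ hv₀
    simp only [Finset.mem_insert, Finset.mem_singleton] at hu₀ hv₀
    exact hside ⟨hu₀.resolve_left hpu.symm, hv₀.resolve_left hpv.symm⟩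
  obtain ⟨g, hg, hg0, hgcard⟩ := (orderKTri_iff (by simp)).1 (hT.2 _ hxy)
  simp only [Finset.mem_insert, Finset.mem_singleton, forall_eq_or_imp, forall_eq] at hg0
  obtain ⟨gp, gx, gy⟩ := hg0
  have fx : 0 ≤ f x := by
    by_contra! h
    exact hpx (hfP x hx h).symm
  have fy : 0 ≤ f y := by
    by_contra! h
    exact hpy (hfP y hy h).symm
  have fm : f ((1 - σ) • u + σ • v) < 0 := by
    rw [hf.comb₂ u v (by ring), fu, fv]
    have := mul_pos (mul_pos (sub_pos.2 hσ1) hσ0) (pow_pos (dist_pos.2 huv) 2)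
    linarith
  have hst : 1 ≤ s + t := by
    by_contra! hlt
    exact hno σ hσ0.le hσ1.le ((mem_interior_triSet hcr).2
      ⟨1 - s - t, s, t, by linarith, hs, ht, by ring, hm⟩)
  have gu : g u ≤ 0 := circumdisk_mem_of_far_side hf hg hcr fp fm fu fx fy hm hs ht hst
    (fun τ h0 h1 => by
      rw [show (1 - τ) • ((1 - σ) • u + σ • v) + τ • u =
        (1 - (1 - τ) * σ) • u + ((1 - τ) * σ) • v by module]
      exact hno _ (mul_nonneg (by linarith) hσ0.le) (by nlinarith)) gp gx gy
  have gv : g v ≤ 0 := circumdisk_mem_of_far_side hf hg hcr fp fm fv fx fy hm hs ht hst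
    (fun τ h0 h1 => by
      rw [show (1 - τ) • ((1 - σ) • u + σ • v) + τ • v =
        (1 - ((1 - τ) * σ + τ)) • u + ((1 - τ) * σ + τ) • v by module]
      exact hno _ (by nlinarith) (by nlinarith)) gp gx gy
  have gq : g q < 0 := neg_of_opposite he hg hopp eu ev ep eq gu gv gp
  have honly : ∀ z ∈ P, z ≠ q → 0 ≤ g z := fun z hz hzq => by
    by_contra! h
    have hle : {p ∈ P | g p < 0}.encard ≤ 1 := by simpa using hgcard
    exact hzq (Set.encard_le_one_iff.1 hle z q ⟨hz, h⟩ ⟨hq, gq⟩)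
  refine hside ⟨?_, ?_⟩
  · exact (hgp.not_concyclic hg hp hx hy hu hpx hpy hne gp gx gy
      (le_antisymm gu (honly u hu huq))).resolve_left hpu.symm
  · exact (hgp.not_concyclic hg hp hx hy hv hpx hpy hne gp gx gy
      (le_antisymm gv (honly v hv hvq))).resolve_left hpv.symm

end OrderOne

/-! ### Flip configurations -/

theorem IsCircleFun.exists_sub_eq_mul {f g : Pt → ℝ} (hf : IsCircleFun f) (hg : IsCircleFun g)
    {u v p : Pt} (hu : f u = g u) (hv : f v = g v) (hp : cr u v p ≠ 0) (q : Pt) :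
    ∃ γ : ℝ, f q - g q = γ * (f p - g p) ∧ cr u v q = γ * cr u v p := by
  obtain ⟨a, b, c, hsum, hq⟩ := exists_barycentric hp q
  refine ⟨c, ?_, ?_⟩
  · rw [hq, hf.sub_comb hg _ _ _ hsum, hu, hv]; ring
  · rw [hq, cr_comb _ _ _ _ _ hsum, cr_left, cr_right]; ring

theorem IsCircleFun.exists_pos_mul_of_same_side {f g : Pt → ℝ} (hf : IsCircleFun f)
    (hg : IsCircleFun g) {u v p q : Pt} (hu : f u = g u) (hv : f v = g v)
    (h : 0 < cr u v p * cr u v q) : ∃ γ : ℝ, 0 < γ ∧ f q - g q = γ * (f p - g p) := by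
  obtain ⟨γ, h1, h2⟩ := hf.exists_sub_eq_mul hg hu hv (left_ne_zero_of_mul h.ne') q
  refine ⟨γ, ?_, h1⟩
  by_contra! hγ
  rw [h2] at h
  nlinarith [mul_nonneg (neg_nonneg.2 hγ) (mul_self_nonneg (cr u v p))]

theorem IsCircleFun.exists_neg_mul_of_opposite {f g : Pt → ℝ} (hf : IsCircleFun f)
    (hg : IsCircleFun g) {u v p q : Pt} (hu : f u = g u) (hv : f v = g v)
    (h : cr u v p * cr u v q < 0) : ∃ γ : ℝ, γ < 0 ∧ f q - g q = γ * (f p - g p) := by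
  obtain ⟨γ, h1, h2⟩ := hf.exists_sub_eq_mul hg hu hv (left_ne_zero_of_mul h.ne) q
  refine ⟨γ, ?_, h1⟩
  by_contra! hγ
  rw [h2] at h
  nlinarith [mul_nonneg hγ (mul_self_nonneg (cr u v p))]

/-- The segments `uv` and `ab` cross, the circumdisk of `uva` contains only `b`, and the
circumdisk of `uvb` contains only `a`. -/
structure IsFlipQuad (P : Set Pt) (u v a b : Pt) : Prop where
  left_mem : u ∈ P
  right_mem : v ∈ P
  fst_mem : a ∈ P
  snd_mem : b ∈ P
  ne : u ≠ v
  crossing : ∃ s t : ℝ, 0 < s ∧ s < 1 ∧ 0 < t ∧ t < 1 ∧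
    (1 - s) • u + s • v = (1 - t) • a + t • b
  disk_fst : ∃ f, IsCircleFun f ∧ f u = 0 ∧ f v = 0 ∧ f a = 0 ∧ f b < 0 ∧
    ∀ p ∈ P, f p < 0 → p = b
  disk_snd : ∃ f, IsCircleFun f ∧ f u = 0 ∧ f v = 0 ∧ f b = 0 ∧ f a < 0 ∧
    ∀ p ∈ P, f p < 0 → p = a

section FlipQuad

variable {P : Set Pt} {T : Set (Finset Pt)} {u v a b : Pt}

theorem IsFlipQuad.swap_edge (h : IsFlipQuad P u v a b) : IsFlipQuad P v u a b where
  left_mem := h.right_mem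
  right_mem := h.left_mem
  fst_mem := h.fst_mem
  snd_mem := h.snd_mem
  ne := h.ne.symm
  crossing := by
    obtain ⟨s, t, h1, h2, h3, h4, h5⟩ := h.crossing
    refine ⟨1 - s, t, by linarith, by linarith, h3, h4, ?_⟩
    rw [← h5]; module
  disk_fst := by
    obtain ⟨f, hf, h1, h2, h3⟩ := h.disk_fst
    exact ⟨f, hf, h2, h1, h3⟩
  disk_snd := by
    obtain ⟨f, hf, h1, h2, h3⟩ := h.disk_snd
    exact ⟨f, hf, h2, h1, h3⟩

theorem IsFlipQuad.swap_apex (h : IsFlipQuad P u v a b) : IsFlipQuad P u v b a where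
  left_mem := h.left_mem
  right_mem := h.right_mem
  fst_mem := h.snd_mem
  snd_mem := h.fst_mem
  ne := h.ne
  crossing := by
    obtain ⟨s, t, h1, h2, h3, h4, h5⟩ := h.crossing
    refine ⟨s, 1 - t, h1, h2, by linarith, by linarith, ?_⟩
    rw [h5]; module
  disk_fst := h.disk_snd
  disk_snd := h.disk_fst

theorem IsFlipQuad.left_ne_fst (h : IsFlipQuad P u v a b) : u ≠ a := by
  obtain ⟨f, -, fu, -, -, fa, -⟩ := h.disk_snd
  rintro rfl; linarith

theorem IsFlipQuad.left_ne_snd (h : IsFlipQuad P u v a b) : u ≠ b := h.swap_apex.left_ne_fst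

theorem IsFlipQuad.right_ne_fst (h : IsFlipQuad P u v a b) : v ≠ a := h.swap_edge.left_ne_fst

theorem IsFlipQuad.right_ne_snd (h : IsFlipQuad P u v a b) : v ≠ b := h.swap_edge.left_ne_snd

theorem IsFlipQuad.fst_ne_snd (h : IsFlipQuad P u v a b) : a ≠ b := by
  obtain ⟨f, -, -, -, fa, fb, -⟩ := h.disk_fst
  rintro rfl; linarith

theorem exists_crossing_of_opposite {f : Pt → ℝ} (hf : IsCircleFun f)
    (hopp : cr u v a * cr u v b < 0) (fu : f u = 0) (fv : f v = 0) (fa : f a ≤ 0)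
    (fb : f b < 0) :
    ∃ s t : ℝ, 0 < s ∧ s < 1 ∧ 0 < t ∧ t < 1 ∧ (1 - s) • u + s • v = (1 - t) • a + t • b := by
  have hcr : cr u v a ≠ 0 := left_ne_zero_of_mul hopp.ne
  obtain ⟨α, β, γ, hsum, hb⟩ := exists_barycentric hcr b
  have hcb : cr u v b = γ * cr u v a := by
    rw [hb, cr_comb _ _ _ _ _ hsum, cr_left, cr_right]; ring
  have hγ : γ < 0 := by
    rw [hcb] at hopp
    nlinarith [mul_self_nonneg (cr u v a)]
  have h1 : 0 < 1 - γ := by linarith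
  have ht : 1 / (1 - γ) < 1 := by rw [div_lt_one h1]; linarith
  have hk : (α / (1 - γ)) • u + (β / (1 - γ)) • v
      = (1 / (1 - γ)) • b + (1 - 1 / (1 - γ)) • a := by
    rw [hb]; match_scalars <;> field_simp; ring
  have hαβ : α / (1 - γ) + β / (1 - γ) = 1 := by
    rw [← add_div, div_eq_one_iff_eq h1.ne']; linarith
  obtain ⟨hα, hβ⟩ := hf.pos_of_neg hαβ fu fv (by
    rw [hk]
    exact hf.comb₂_neg (by ring) (by positivity) (by linarith) fb fa)
  refine ⟨β / (1 - γ), 1 / (1 - γ), hβ, by linarith, by positivity, ht, ?_⟩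
  rw [add_comm (_ • a), ← hk, show 1 - β / (1 - γ) = α / (1 - γ) by linarith]

/-- An edge of an order-1 Delaunay triangulation that is not an edge of an empty triangle is the
diagonal of a flip configuration. -/
theorem IsOrderDT.exists_isFlipQuad (hT : IsOrderDT P 1 T) (hfin : P.Finite) (hgp : GenPos P)
    {t : Finset Pt} (ht : t ∈ T) (hut : u ∈ t) (hvt : v ∈ t) (huv : u ≠ v)
    (hnot : ∀ s ∈ emptyTriangles P, u ∈ s → v ∉ s) :
    ∃ a b, ({u, v, a} : Finset Pt) ∈ T ∧ ({u, v, b} : Finset Pt) ∈ T ∧ IsFlipQuad P u v a b := by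
  obtain ⟨hcard, hsub⟩ := hT.1.2.1 t ht
  obtain ⟨a, rfl, hua, hva⟩ := exists_third_vertex hcard hut hvt huv
  have hu : u ∈ P := hsub (by simp)
  have hv : v ∈ P := hsub (by simp)
  have ha : a ∈ P := hsub (by simp)
  obtain ⟨f, hf, hf0, hfcard⟩ := (orderKTri_iff (by simp)).1 (hT.2 _ ht)
  simp only [Finset.mem_insert, Finset.mem_singleton, forall_eq_or_imp, forall_eq] at hf0
  obtain ⟨fu, fv, fa⟩ := hf0
  obtain ⟨p, hp, fp⟩ : ∃ p ∈ P, f p < 0 := by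
    by_contra! hall
    exact hnot _ ⟨hcard, hsub, f, hf, by simp [fu, fv, fa], hall⟩ (by simp) (by simp)
  have hfle : {p ∈ P | f p < 0}.encard ≤ 1 := by simpa using hfcard
  have hfP : ∀ z ∈ P, f z < 0 → z = p := fun z hz h =>
    Set.encard_le_one_iff.1 hfle z p ⟨hz, h⟩ ⟨hp, fp⟩
  have hup : u ≠ p := by rintro rfl; linarith
  have hvp : v ≠ p := by rintro rfl; linarith
  have hap : a ≠ p := by rintro rfl; linarith
  have hcra : cr u v a ≠ 0 := hgp.cr_ne_zero hu hv ha huv hua hva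
  have hcrp : cr u v p ≠ 0 := hgp.cr_ne_zero hu hv hp huv hup hvp
  obtain ⟨e, he, eu, ev, ep⟩ := exists_circleFun hcrp
  obtain ⟨q, hq, eq, hq1⟩ : ∃ q ∈ P, e q < 0 ∧ cr u v p * cr u v q < 0 := by
    by_contra! hall
    refine hnot {u, v, p} ⟨Finset.card_eq_three.2 ⟨u, v, p, huv, hup, hvp, rfl⟩,
      by simp [Set.insert_subset_iff, hu, hv, hp], e, he, by simp [eu, ev, ep],
      fun z hz => ?_⟩ (by simp) (by simp)
    by_contra! hez
    have hzu : u ≠ z := by rintro rfl; linarith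
    have hzv : v ≠ z := by rintro rfl; linarith
    have hcrz : cr u v z ≠ 0 := hgp.cr_ne_zero hu hv hz huv hzu hzv
    have hpos := (hall z hz hez).lt_of_ne' (mul_ne_zero hcrp hcrz)
    obtain ⟨γ, hγ, h1⟩ := he.exists_pos_mul_of_same_side hf (eu.trans fu.symm)
      (ev.trans fv.symm) hpos
    have hfz : f z < 0 := by
      have := mul_pos hγ (neg_pos.2 fp)
      rw [ep] at h1; linarith
    rw [hfP z hz hfz] at hez
    linarith
  have hmem := hT.triangle_mem hfin hgp ht hut hvt hu hv hp hq huv hf fu fv fp hfP he eu ev ep eq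
    hq1
  have hopp : cr u v a * cr u v p < 0 := by
    refine (mul_ne_zero hcra hcrp).lt_or_gt.resolve_right fun hpos => ?_
    exact hap (hT.1.eq_of_same_side hgp ht hmem hpos)
  obtain ⟨g, hg, hg0, hgcard⟩ := (orderKTri_iff (by simp)).1 (hT.2 _ hmem)
  simp only [Finset.mem_insert, Finset.mem_singleton, forall_eq_or_imp, forall_eq] at hg0
  obtain ⟨gu, gv, gp⟩ := hg0
  have ga : g a < 0 := by
    obtain ⟨γ, hγ, h1⟩ := hg.exists_neg_mul_of_opposite hf (gu.trans fu.symm) (gv.trans fv.symm)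
      (mul_comm (cr u v a) _ ▸ hopp)
    have := mul_pos_of_neg_of_neg hγ fp
    rw [gp, fa] at h1; linarith
  have hgle : {p ∈ P | g p < 0}.encard ≤ 1 := by simpa using hgcard
  exact ⟨a, p, ht, hmem, hu, hv, ha, hp, huv,
    exists_crossing_of_opposite hf hopp fu fv fa.le fp, ⟨f, hf, fu, fv, fa, fp, hfP⟩,
    ⟨g, hg, gu, gv, gp, ga, fun z hz h =>
      Set.encard_le_one_iff.1 hgle z a ⟨hz, h⟩ ⟨ha, ga⟩⟩⟩

/-- If `z` lies in the cone opposite to the angle `aub`, it is outside the circumdisk of `uab`. -/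
theorem IsCircleFun.nonneg_of_opposite_cone {e : Pt → ℝ} (he : IsCircleFun e) (eu : e u = 0)
    (ea : e a = 0) (eb : e b = 0) {α β : ℝ} (hα : α ≤ 0) (hβ : β ≤ 0) :
    0 ≤ e ((1 - α - β) • u + α • a + β • b) := by
  obtain ⟨A, B, C, h⟩ := he
  rw [h] at eu ea eb
  have key : e ((1 - α - β) • u + α • a + β • b) =
      (α * (a 0 - u 0) + β * (b 0 - u 0)) ^ 2 + (α * (a 1 - u 1) + β * (b 1 - u 1)) ^ 2
      + -α * ((a 0 - u 0) ^ 2 + (a 1 - u 1) ^ 2) + -β * ((b 0 - u 0) ^ 2 + (b 1 - u 1) ^ 2) := by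
    rw [h]
    simp only [PiLp.add_apply, PiLp.smul_apply, smul_eq_mul]
    linear_combination (1 - α - β) * eu + α * ea + β * eb
  rw [key]
  have := neg_nonneg.2 hα
  have := neg_nonneg.2 hβ
  positivity

theorem IsFlipQuad.emptyTriangle_left (h : IsFlipQuad P u v a b) (hgp : GenPos P) :
    ({u, a, b} : Finset Pt) ∈ emptyTriangles P := by
  have hua := h.left_ne_fst
  have hub := h.left_ne_snd
  have hab := h.fst_ne_snd
  have hcr : cr u a b ≠ 0 := hgp.cr_ne_zero h.left_mem h.fst_mem h.snd_mem hua hub hab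
  obtain ⟨e, he, eu, ea, eb⟩ := exists_circleFun hcr
  obtain ⟨f, hf, fu, fv, fa, fb, hfP⟩ := h.disk_fst
  obtain ⟨g, hg, gu, gv, gb, ga, hgP⟩ := h.disk_snd
  refine ⟨Finset.card_eq_three.2 ⟨u, a, b, hua, hub, hab, rfl⟩,
    by simp [Set.insert_subset_iff, h.left_mem, h.fst_mem, h.snd_mem], e, he,
    by simp [eu, ea, eb], fun q hq => ?_⟩
  by_contra! eq
  have fq : 0 ≤ f q := by
    by_contra! hneg
    rw [hfP q hq hneg] at eq; linarith
  have gq : 0 ≤ g q := by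
    by_contra! hneg
    rw [hgP q hq hneg] at eq; linarith
  obtain ⟨c, α, β, hsum, hqe⟩ := exists_barycentric hcr q
  have h1 := he.sub_comb hf u a b hsum
  have h2 := he.sub_comb hg u a b hsum
  rw [← hqe, eu, ea, eb, fu, fa] at h1
  rw [← hqe, eu, ea, eb, gu, gb] at h2
  have hβ : β ≤ 0 := by
    by_contra! hpos
    linarith [mul_pos hpos (neg_pos.2 fb)]
  have hα : α ≤ 0 := by
    by_contra! hpos
    linarith [mul_pos hpos (neg_pos.2 ga)]
  have := he.nonneg_of_opposite_cone eu ea eb hα hβ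
  rw [show (1 : ℝ) - α - β = c by linarith, ← hqe] at this
  linarith

theorem IsFlipQuad.emptyTriangle_right (h : IsFlipQuad P u v a b) (hgp : GenPos P) :
    ({v, a, b} : Finset Pt) ∈ emptyTriangles P := h.swap_edge.emptyTriangle_left hgp

end FlipQuad

section Fixed

variable {P : Set Pt} {T : Set (Finset Pt)} {u v a b : Pt}

/-- Two flip configurations cannot share the edge `ub` with `a` as common opposite corner. -/
theorem IsFlipQuad.not_adjacent (h : IsFlipQuad P u v a b) (hgp : GenPos P) {y : Pt}
    (h' : IsFlipQuad P b y u a) : False := by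
  obtain ⟨s, t, hs0, hs1, ht0, ht1, hk⟩ := h.crossing
  obtain ⟨s', t', hs0', hs1', ht0', ht1', hk'⟩ := h'.crossing
  have hua := h.left_ne_fst
  have hub := h.left_ne_snd
  have hab := h.fst_ne_snd
  have hcr : cr u a b ≠ 0 := hgp.cr_ne_zero h.left_mem h.fst_mem h.snd_mem hua hub hab
  have hcr' : cr u b a ≠ 0 := hgp.cr_ne_zero h.left_mem h.snd_mem h.fst_mem hub hua hab.symm
  have e1 := congrArg (cr u b) hk
  have e2 := congrArg (cr u b) hk'
  have e3 := congrArg (cr u a) hk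
  have e4 := congrArg (cr u a) hk'
  simp only [cr_comb₂ _ _ _ _ (show 1 - s + s = 1 by ring),
    cr_comb₂ _ _ _ _ (show 1 - t + t = 1 by ring), cr_left, cr_right, mul_zero, zero_add,
    add_zero] at e1 e3
  simp only [cr_comb₂ _ _ _ _ (show 1 - s' + s' = 1 by ring),
    cr_comb₂ _ _ _ _ (show 1 - t' + t' = 1 by ring), cr_left, cr_right, mul_zero, zero_add,
    add_zero] at e2 e4
  have hvy : v ≠ y := by
    rintro rfl
    have : ((1 - s') * s + s' * t) * cr u a b = 0 := by linear_combination s * e4 - s' * e3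
    have hpos : 0 < (1 - s') * s + s' * t :=
      add_pos (mul_pos (by linarith) hs0) (mul_pos hs0' ht0)
    exact (mul_ne_zero hpos.ne' hcr) this
  have hside : 0 < cr u b v * cr u b y := by
    have h1 : (s * s') * (cr u b v * cr u b y) =
        ((1 - t) * t') * (cr u b a * cr u b a) := by
      linear_combination s' * cr u b y * e1 + (1 - t) * cr u b a * e2
    have h2 := mul_pos (mul_pos (sub_pos.2 ht1) ht0') (mul_self_pos.2 hcr')
    rw [← h1] at h2
    exact pos_of_mul_pos_right h2 (mul_pos hs0 hs0').le
  obtain ⟨g, hg, gu, gv, gb, ga, hgP⟩ := h.disk_snd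
  obtain ⟨f, hf, fb, fy, fu, fa, hfP⟩ := h'.disk_fst
  have fv : 0 ≤ f v := by
    by_contra! hneg
    exact h.right_ne_fst (hfP v h.right_mem hneg)
  have gy : 0 ≤ g y := by
    by_contra! hneg
    exact h'.right_ne_snd (hgP y h'.right_mem hneg)
  obtain ⟨γ, hγ, hfg⟩ := hf.exists_pos_mul_of_same_side hg (fu.trans gu.symm) (fb.trans gb.symm)
    hside
  have fv0 : f v = 0 := by
    by_contra hne
    have := mul_pos hγ (fv.lt_of_ne' hne)
    rw [fy, gv] at hfg
    linarith
  rcases hgp.not_concyclic hf h.left_mem h.snd_mem h'.right_mem h.right_mem hub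
    h'.right_ne_fst.symm h'.ne fu fb fy fv0 with h1 | h1 | h1
  · exact h.ne h1.symm
  · exact h.right_ne_snd h1
  · exact hvy h1

/-- A disk through two points whose segment crosses an edge `ua` of an empty triangle contains
`u` or `a`. -/
theorem GenPos.neg_or_neg_of_crossing (hgp : GenPos P) {e : Pt → ℝ} (he : IsCircleFun e)
    (hu : u ∈ P) (ha : a ∈ P) (hb : b ∈ P) (hua : u ≠ a) (hub : u ≠ b) (hab : a ≠ b)
    (eu : e u = 0) (ea : e a = 0) (eb : e b = 0) (heP : ∀ p ∈ P, 0 ≤ e p) {x y : Pt}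
    (hx : x ∈ P) (hy : y ∈ P) (hxy : x ≠ y) (hxu : x ≠ u) (hxa : x ≠ a) (hyu : y ≠ u)
    (hya : y ≠ a) {σ τ : ℝ} (hσ0 : 0 < σ) (hσ1 : σ < 1) (hτ0 : 0 ≤ τ) (hτ1 : τ ≤ 1)
    (hk : (1 - σ) • x + σ • y = (1 - τ) • u + τ • a) {g : Pt → ℝ} (hg : IsCircleFun g)
    (gx : g x = 0) (gy : g y = 0) : g u < 0 ∨ g a < 0 := by
  by_contra! hpos
  have h1 := he.sub_comb₂ hg x y (show 1 - σ + σ = 1 by ring)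
  have h2 := he.sub_comb₂ hg u a (show 1 - τ + τ = 1 by ring)
  rw [hk, h2, eu, ea, gx, gy] at h1
  have p1 := mul_nonneg (sub_nonneg.2 hτ1) hpos.1
  have p2 := mul_nonneg hτ0 hpos.2
  have p3 := mul_nonneg (sub_nonneg.2 hσ1.le) (heP x hx)
  have p4 := mul_nonneg hσ0.le (heP y hy)
  have ex : e x = 0 :=
    (mul_eq_zero.1 (show (1 - σ) * e x = 0 by linarith)).resolve_left (by linarith)
  have ey : e y = 0 := (mul_eq_zero.1 (show σ * e y = 0 by linarith)).resolve_left hσ0.ne'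
  have hxb := ((hgp.not_concyclic he hu ha hb hx hua hub hab eu ea eb ex).resolve_left
    hxu).resolve_left hxa
  have hyb := ((hgp.not_concyclic he hu ha hb hy hua hub hab eu ea eb ey).resolve_left
    hyu).resolve_left hya
  exact hxy (hxb.trans hyb.symm)

/-- The side `ua` of a flip configuration is not a diagonal of another one. -/
theorem IsFlipQuad.side_not_flip (h : IsFlipQuad P u v a b) (hfin : P.Finite) (hgp : GenPos P)
    {x y : Pt} (h' : IsFlipQuad P x y u a) : False := by
  have hE := (isOrderDT_emptyTriangles hfin hgp h.left_mem h.right_mem h.fst_mem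
    (hgp.cr_ne_zero h.left_mem h.right_mem h.fst_mem h.ne h.left_ne_fst h.right_ne_fst)).1
  have hb := h.emptyTriangle_left hgp
  have hx : ({u, a, x} : Finset Pt) ∈ emptyTriangles P := by
    have := h'.emptyTriangle_left hgp
    rwa [show ({u, a, x} : Finset Pt) = {x, u, a} by ext; simp; tauto]
  have hy : ({u, a, y} : Finset Pt) ∈ emptyTriangles P := by
    have := h'.emptyTriangle_right hgp
    rwa [show ({u, a, y} : Finset Pt) = {y, u, a} by ext; simp; tauto]
  obtain ⟨s, t, hs0, hs1, ht0, ht1, hk⟩ := h'.crossing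
  have hcb : cr u a b ≠ 0 := hgp.cr_ne_zero h.left_mem h.fst_mem h.snd_mem h.left_ne_fst
    h.left_ne_snd h.fst_ne_snd
  have hcx : cr u a x ≠ 0 := hgp.cr_ne_zero h.left_mem h.fst_mem h'.left_mem h.left_ne_fst
    h'.left_ne_fst.symm h'.left_ne_snd.symm
  have e1 := congrArg (cr u a) hk
  rw [cr_comb₂ _ _ _ _ (by ring), cr_comb₂ _ _ _ _ (by ring), cr_left, cr_right] at e1
  rcases (mul_ne_zero hcb hcx).lt_or_gt with hneg | hpos
  · have hby : 0 < cr u a b * cr u a y := by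
      have h1 : s * (cr u a b * cr u a y) = (1 - s) * -(cr u a b * cr u a x) := by
        linear_combination cr u a b * e1
      have h2 := mul_pos (sub_pos.2 hs1) (neg_pos.2 hneg)
      rw [← h1] at h2
      exact pos_of_mul_pos_right h2 hs0.le
    obtain rfl := hE.eq_of_same_side hgp hb hy hby
    exact h.not_adjacent hgp h'.swap_edge
  · obtain rfl := hE.eq_of_same_side hgp hb hx hpos
    exact h.not_adjacent hgp h'

theorem IsFlipQuad.kFixed (h : IsFlipQuad P u v a b) (hfin : P.Finite) (hgp : GenPos P) :
    KFixed P 1 u a := by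
  have hu := h.left_mem
  have ha := h.fst_mem
  have hua := h.left_ne_fst
  have hE := isOrderDT_emptyTriangles hfin hgp hu h.right_mem ha
    (hgp.cr_ne_zero hu h.right_mem ha h.ne hua h.right_ne_fst)
  have hempty := h.emptyTriangle_left hgp
  refine ⟨⟨_, hE, _, hempty, by simp, by simp⟩, fun T hT => ?_⟩
  by_contra! hno
  obtain ⟨x, y, ht, hux, huy, hxy, s, r, hs, hr, hm⟩ :=
    hT.1.exists_toward hgp hu (subset_convexHull ℝ P ha)
  have hax : a ≠ x := by
    rintro rfl
    exact hno _ ht (by simp) (by simp)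
  have hay : a ≠ y := by
    rintro rfl
    exact hno _ ht (by simp) (by simp)
  have hsub := (hT.1.2.1 _ ht).2
  have hx : x ∈ P := hsub (by simp)
  have hy : y ∈ P := hsub (by simp)
  have hs : 0 < s := hs.lt_of_ne' fun h0 => hgp.cr_ne_zero hu hy ha huy hua hay.symm (by
    rw [hm, cr_comb _ _ _ _ _ (by ring), cr_left, cr_right, h0]; ring)
  have hr : 0 < r := hr.lt_of_ne' fun h0 => hgp.cr_ne_zero hu hx ha hux hua hax.symm (by
    rw [hm, cr_comb _ _ _ _ _ (by ring), cr_left, cr_right, h0]; ring)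
  have hsr : 1 < s + r := by
    by_contra! hle
    refine hno _ ht (by simp) (hT.1.vertex_of_mem hgp ht ha ?_)
    rw [mem_triSet]
    exact ⟨1 - s - r, s, r, by linarith, hs.le, hr.le, by ring, hm⟩
  have hsr0 : 0 < s + r := by linarith
  have hk : (1 - r / (s + r)) • x + (r / (s + r)) • y =
      (1 - 1 / (s + r)) • u + (1 / (s + r)) • a := by
    rw [hm]; match_scalars <;> field_simp <;> ring
  obtain ⟨-, -, e, he, he0, heP⟩ := id hempty
  simp only [Finset.mem_insert, Finset.mem_singleton, forall_eq_or_imp, forall_eq] at he0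
  have hcross : ∀ {g : Pt → ℝ}, IsCircleFun g → g x = 0 → g y = 0 → g u < 0 ∨ g a < 0 :=
    fun hg gx gy => hgp.neg_or_neg_of_crossing he hu ha h.snd_mem hua h.left_ne_snd h.fst_ne_snd
      he0.1 he0.2.1 he0.2.2 heP hx hy hxy hux.symm hax.symm huy.symm hay.symm
      (div_pos hr hsr0) (by rw [div_lt_one hsr0]; linarith) (by positivity)
      (by rw [div_le_one hsr0]; linarith) hk hg gx gy
  obtain ⟨c, d, -, -, hq⟩ := hT.exists_isFlipQuad hfin hgp (u := x) (v := y) ht (by simp)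
    (by simp) hxy (by
      rintro w ⟨-, -, g, hg, hg0, hgP⟩ hxw hyw
      rcases hcross hg (hg0 x hxw) (hg0 y hyw) with h1 | h1
      · linarith [hgP u hu]
      · linarith [hgP a ha])
  have hd : u = d ∨ a = d := by
    obtain ⟨f, hf, fx, fy, -, -, hfP⟩ := hq.disk_fst
    exact (hcross hf fx fy).imp (hfP u hu) (hfP a ha)
  have hc : u = c ∨ a = c := by
    obtain ⟨f, hf, fx, fy, -, -, hfP⟩ := hq.disk_snd
    exact (hcross hf fx fy).imp (hfP u hu) (hfP a ha)
  have hcd := hq.fst_ne_snd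
  rcases hc with rfl | rfl <;> rcases hd with rfl | rfl
  · exact hcd rfl
  · exact h.side_not_flip hfin hgp hq
  · exact h.side_not_flip hfin hgp hq.swap_apex
  · exact hcd rfl

end Fixed

/-- Observation 2.7: if `{u,v}` is a useful order-1, non-Delaunay, edge of an order-1
Delaunay triangulation `T`, then the two triangles of `T` adjacent to `uv`, say
`u v a` and `u v b`, form a convex quadrilateral, flipping `uv` yields the Delaunay
edge `{a,b}`, and the four edges `{u,a}, {u,b}, {v,a}, {v,b}` are 1-fixed. -/
theorem flip_of_useful_one_edge
    (P : Set Pt) (hfin : P.Finite) (hgp : GenPos P)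
    (T : Set (Finset Pt)) (hT : IsOrderDT P 1 T)
    (u v : Pt) (hu : u ∈ P) (hv : v ∈ P) (huv : u ≠ v)
    (hside : ∃ t ∈ T, u ∈ t ∧ v ∈ t)
    (huseful : UsefulEdge P 1 u v) (hnotdel : ¬ DelaunayEdge P u v) :
    ∃ a b : Pt, a ≠ b ∧
      ({u, v, a} : Finset Pt) ∈ T ∧ ({u, v, b} : Finset Pt) ∈ T ∧
      -- the four points are in convex position, i.e. `u a v b` is a convex quadrilateral
      (a ∉ convexHull ℝ ({u, v, b} : Set Pt)) ∧
      (b ∉ convexHull ℝ ({u, v, a} : Set Pt)) ∧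
      (u ∉ convexHull ℝ ({v, a, b} : Set Pt)) ∧
      (v ∉ convexHull ℝ ({u, a, b} : Set Pt)) ∧
      DelaunayEdge P a b ∧
      KFixed P 1 u a ∧ KFixed P 1 u b ∧ KFixed P 1 v a ∧ KFixed P 1 v b := by
  obtain ⟨t, ht, hut, hvt⟩ := hside
  obtain ⟨x, y, z, -, hx, hy, hz, -, -, -, hcr⟩ :=
    hgp.exists_triple (hT.1.2.1 t ht).1 (hT.1.2.1 t ht).2
  have hE := isOrderDT_emptyTriangles hfin hgp hx hy hz hcr
  obtain ⟨a, b, hta, htb, h⟩ := hT.exists_isFlipQuad hfin hgp ht hut hvt huv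
    fun s hs hus hvs => hnotdel ⟨_, hE, s, hs, hus, hvs⟩
  have hvertex : ∀ {T' : Set (Finset Pt)}, IsTriangulation P T' → ∀ {p q r w : Pt},
      ({p, q, r} : Finset Pt) ∈ T' → w ∈ P → w ≠ p → w ≠ q → w ≠ r →
      w ∉ convexHull ℝ ({p, q, r} : Set Pt) := fun hT' p q r w hmem hw hp hq hr hconv => by
    have := hT'.vertex_of_mem hgp hmem hw (by simpa [triSet] using hconv)
    simp [hp, hq, hr] at this
  have hl := h.emptyTriangle_left hgp
  have hr := h.emptyTriangle_right hgp
  exact ⟨a, b, h.fst_ne_snd, hta, htb,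
    hvertex hT.1 htb h.fst_mem h.left_ne_fst.symm h.right_ne_fst.symm h.fst_ne_snd,
    hvertex hT.1 hta h.snd_mem h.left_ne_snd.symm h.right_ne_snd.symm h.fst_ne_snd.symm,
    hvertex hE.1 hr hu huv h.left_ne_fst h.left_ne_snd,
    hvertex hE.1 hl hv huv.symm h.right_ne_fst h.right_ne_snd,
    ⟨_, hE, _, hl, by simp, by simp⟩, h.kFixed hfin hgp, h.swap_apex.kFixed hfin hgp,
    h.swap_edge.kFixed hfin hgp, h.swap_edge.swap_apex.kFixed hfin hgp⟩

end
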